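/- arXiv:2603.16135 — 2 statements merged into one kernel-verified Lean document; each statement's English description precedes it below -/
import Mathlib

section
/- There exists a universal numeric constant c > 0 such that for every n ≥ 2, every bounded convex domain Ω in ℝⁿ, and all integers k ≥ l ≥ 1, the Neumann eigenvalues of the Laplacian satisfy μ_k(Ω) ≥ (1/(c·n^10)) · (k/l)^(2/n) · μ_l(Ω). -/
open MeasureTheory

/-- The `k`-th Neumann eigenvalue of the Laplacian on `Ω ⊆ ℝⁿ`, defined via the
Courant–Fischer min-max principle: the infimum over `(k+1)`-dimensional spaces `V`
of test functions (smooth functions, distinguished by their restrictions to `Ω`)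
of the supremum of the Rayleigh quotient `∫_Ω ‖∇f‖² / ∫_Ω f²` over nonzero `f ∈ V`. -/
noncomputable def neumannEigenvalue (n : ℕ) (k : ℕ)
    (Ω : Set (EuclideanSpace ℝ (Fin n))) : ℝ :=
  ⨅ V : {V : Submodule ℝ (EuclideanSpace ℝ (Fin n) → ℝ) //
      Module.finrank ℝ V = k + 1 ∧ (∀ f ∈ V, ContDiff ℝ (⊤ : ℕ∞) f) ∧
      ∀ f ∈ V, (∀ x ∈ Ω, f x = 0) → f = 0},
    ⨆ f : {f : EuclideanSpace ℝ (Fin n) → ℝ // f ∈ V.1 ∧ f ≠ 0},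
      (∫ x in Ω, ‖fderiv ℝ f.1 x‖ ^ 2) / ∫ x in Ω, (f.1 x) ^ 2


namespace NeumannAux

abbrev Eu (n : ℕ) := EuclideanSpace ℝ (Fin n)

lemma half_le_pow (n : ℕ) (hn : 1 ≤ n) (t : ℝ) (ht0 : 0 ≤ t) (ht : t ≤ 1 / (2 * n)) :
    (1 : ℝ) / 2 ≤ (1 - t) ^ n := by
  have hn' : (1 : ℝ) ≤ n := by exact_mod_cast hn
  have h1 : (n : ℝ) * t ≤ 1 / 2 := by
    calc (n : ℝ) * t ≤ n * (1 / (2 * n)) := by gcongr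
      _ = 1 / 2 := by field_simp
  have h2 : t ≤ 1 / 2 := by nlinarith
  have := one_add_mul_le_pow (a := -t) (by linarith) n
  have e : (1 - t) = 1 + -t := by ring
  rw [e]
  linarith

lemma cauchy_schwarz {α : Type*} [MeasurableSpace α] (μ : Measure α) [IsFiniteMeasure μ]
    (f : α → ℝ) (hf : Integrable f μ) (hf2 : Integrable (fun x => f x ^ 2) μ) :
    (∫ x, f x ∂μ) ^ 2 ≤ μ.real Set.univ * ∫ x, f x ^ 2 ∂μ := by
  set M := μ.real Set.univ with hM
  set I := ∫ x, f x ∂μ with hI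
  have hM0 : 0 ≤ M := measureReal_nonneg
  rcases hM0.eq_or_lt with h | h
  · have : μ = 0 := by
      rw [← Measure.measure_univ_eq_zero]
      have := h.symm
      rw [hM, measureReal_def, ENNReal.toReal_eq_zero_iff] at this
      simpa using this
    simp [hI, this]
  · have h0 : 0 ≤ ∫ x, (M * f x - I) ^ 2 ∂μ := integral_nonneg fun x => sq_nonneg _
    have e : ∫ x, (M * f x - I) ^ 2 ∂μ = M ^ 2 * (∫ x, f x ^ 2 ∂μ) - 2 * M * I * I + I ^ 2 * M := by
      have : ∀ x, (M * f x - I) ^ 2 = M ^ 2 * f x ^ 2 - 2 * M * I * f x + I ^ 2 := by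
        intro x; ring
      simp_rw [this]
      rw [integral_add, integral_sub, integral_const_mul, integral_const_mul, integral_const]
      · simp only [smul_eq_mul]; rw [← hM, ← hI]; ring
      · exact hf2.const_mul _
      · exact hf.const_mul _
      · exact (hf2.const_mul _).sub (hf.const_mul _)
      · exact integrable_const _
    rw [e] at h0
    have : 0 ≤ M * (M * (∫ x, f x ^ 2 ∂μ) - I ^ 2) := by nlinarith
    have := nonneg_of_mul_nonneg_right this h
    linarith

lemma integrableOn_of_bounded {n : ℕ} {F : Type*} [NormedAddCommGroup F] {K : Set (Eu n)}
    (hK : Bornology.IsBounded K) {f : Eu n → F} (hf : Continuous f) :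
    IntegrableOn f K volume :=
  (hf.continuousOn.integrableOn_compact hK.isCompact_closure).mono_set subset_closure

lemma volume_ne_top {n : ℕ} {K : Set (Eu n)}
    (hK : Bornology.IsBounded K) : volume K ≠ ⊤ := hK.measure_lt_top.ne

/-- derivative and injectivity data for the maps `x ↦ a • x + w` -/
lemma hasFDeriv_aff {n : ℕ} (a : ℝ) (w : Eu n) (K : Set (Eu n)) (x : Eu n) :
    HasFDerivWithinAt (fun x : Eu n => a • x + w) (a • ContinuousLinearMap.id ℝ (Eu n)) K x :=
  (((hasFDerivAt_id x).const_smul a).add_const w).hasFDerivWithinAt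

lemma injOn_aff {n : ℕ} (a : ℝ) (ha : a ≠ 0) (w : Eu n) (K : Set (Eu n)) :
    Set.InjOn (fun x : Eu n => a • x + w) K := by
  intro x _ y _ h
  simpa [ha] using h

lemma det_aff {n : ℕ} (a : ℝ) :
    (a • ContinuousLinearMap.id ℝ (Eu n)).det = a ^ n := by
  simp [ContinuousLinearMap.det]

lemma lintegral_contract {n : ℕ} (hn : 1 ≤ n) {K : Set (Eu n)} (hKm : MeasurableSet K)
    (hKc : Convex ℝ K) (G : Eu n → ENNReal) (y : Eu n) (hy : y ∈ K)
    (t : ℝ) (ht0 : 0 ≤ t) (ht : t ≤ 1 / (2 * n)) :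
    ∫⁻ x in K, G ((1 - t) • x + t • y) ≤ 2 * ∫⁻ x in K, G x := by
  have hp := half_le_pow n hn t ht0 ht
  have hn' : (1 : ℝ) ≤ n := by exact_mod_cast hn
  have h2 : t ≤ 1 / 2 := by
    refine ht.trans ?_
    rw [div_le_div_iff₀ (by positivity) (by positivity)]; linarith
  have hcv := lintegral_image_eq_lintegral_abs_det_fderiv_mul volume hKm
    (fun x _ => hasFDeriv_aff (1 - t) (t • y) K x)
    (injOn_aff (1 - t) (by linarith) (t • y) K) G
  simp only [det_aff] at hcv
  have hsub : (fun x : Eu n => (1 - t) • x + t • y) '' K ⊆ K := by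
    rintro _ ⟨x, hx, rfl⟩
    exact hKc hx hy (by linarith) ht0 (by ring)
  have h3 : ∫⁻ x in K, ENNReal.ofReal |(1 - t) ^ n| * G ((1 - t) • x + t • y) ≤ ∫⁻ x in K, G x := by
    rw [← hcv]; exact lintegral_mono_set hsub
  rw [lintegral_const_mul' _ _ ENNReal.ofReal_ne_top] at h3
  calc ∫⁻ x in K, G ((1 - t) • x + t • y)
      = 2 * (ENNReal.ofReal (1 / 2) * ∫⁻ x in K, G ((1 - t) • x + t • y)) := by
        rw [← mul_assoc]
        have : (2 : ENNReal) * ENNReal.ofReal (1 / 2) = 1 := by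
          rw [show (2 : ENNReal) = ENNReal.ofReal 2 by simp, ← ENNReal.ofReal_mul (by norm_num)]
          norm_num
        rw [this, one_mul]
    _ ≤ 2 * (ENNReal.ofReal |(1 - t) ^ n| * ∫⁻ x in K, G ((1 - t) • x + t • y)) := by
        gcongr
        exact hp.trans (le_abs_self _)
    _ ≤ _ := by gcongr

/-- the average operator on a cell -/
noncomputable def avg {n : ℕ} (K : Set (Eu n)) (ε : ℝ) (f : Eu n → ℝ) (x : Eu n) : ℝ :=
  (volume.real K)⁻¹ * ∫ y in K, f ((1 - ε) • x + ε • y)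

lemma measurable_avg {n : ℕ} (K : Set (Eu n)) (ε : ℝ) (f : Eu n → ℝ) (hf : Continuous f) :
    Measurable (avg K ε f) := by
  unfold avg
  apply Measurable.const_mul
  apply StronglyMeasurable.measurable
  apply StronglyMeasurable.integral_prod_right
  apply Continuous.stronglyMeasurable
  unfold Function.uncurry
  fun_prop

lemma ftc_bound {n : ℕ} (f : Eu n → ℝ) (hf : ContDiff ℝ (⊤ : ℕ∞) f) (x y : Eu n) (ε D : ℝ)
    (hε : 0 ≤ ε) (hD : ‖x - y‖ ≤ D) :
    (f x - f ((1 - ε) • x + ε • y)) ^ 2 ≤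
      ε * D ^ 2 * ∫ t in Set.Ioc 0 ε, ‖fderiv ℝ f ((1 - t) • x + t • y)‖ ^ 2 := by
  have hc : Continuous (fderiv ℝ f) := hf.continuous_fderiv (by simp)
  set γ : ℝ → Eu n := fun t => (1 - t) • x + t • y with hγ
  have hγc : Continuous γ := by fun_prop
  have hγd : ∀ t, HasDerivAt γ (y - x) t := by
    intro t
    have h1 : HasDerivAt (fun t : ℝ => (1 - t) • x) ((-1 : ℝ) • x) t := by
      simpa using ((hasDerivAt_id t).const_sub 1).smul_const x
    have h2 : HasDerivAt (fun t : ℝ => t • y) ((1 : ℝ) • y) t := (hasDerivAt_id t).smul_const y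
    refine (h1.add h2).congr_deriv ?_
    module
  have hd : ∀ t, HasDerivAt (fun t => f (γ t)) (fderiv ℝ f (γ t) (y - x)) t := by
    intro t
    have : HasFDerivAt f (fderiv ℝ f (γ t)) (γ t) :=
      (hf.differentiable (by simp) _).hasFDerivAt
    exact this.comp_hasDerivAt t (hγd t)
  have hcd : Continuous fun t => fderiv ℝ f (γ t) (y - x) := by fun_prop
  have h := intervalIntegral.integral_eq_sub_of_hasDerivAt (a := 0) (b := ε)
    (fun t _ => hd t) (hcd.intervalIntegrable _ _)
  rw [intervalIntegral.integral_of_le hε] at h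
  have hi : ∀ g : ℝ → ℝ, Continuous g → IntegrableOn g (Set.Ioc 0 ε) := fun g hg =>
    hg.integrableOn_Ioc
  have cs := cauchy_schwarz (volume.restrict (Set.Ioc 0 ε)) _ (hi _ hcd) (hi _ (hcd.pow 2))
  rw [h] at cs
  have hv : (volume.restrict (Set.Ioc 0 ε)).real Set.univ = ε := by
    simp [hε]
  rw [hv] at cs
  have e0 : γ 0 = x := by simp [hγ]
  rw [e0] at cs
  calc (f x - f ((1 - ε) • x + ε • y)) ^ 2 = (f (γ ε) - f x) ^ 2 := by rw [hγ]; ring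
    _ ≤ _ := cs
    _ ≤ ε * ∫ t in Set.Ioc 0 ε, D ^ 2 * ‖fderiv ℝ f (γ t)‖ ^ 2 := by
      refine mul_le_mul_of_nonneg_left ?_ hε
      refine integral_mono (hi _ (hcd.pow 2)) (hi _ (by fun_prop)) fun t => ?_
      · have h1 := (fderiv ℝ f (γ t)).le_opNorm (y - x)
        rw [norm_sub_rev] at h1
        have h2 : ‖fderiv ℝ f (γ t) (y - x)‖ ≤ D * ‖fderiv ℝ f (γ t)‖ := by
          rw [mul_comm D]; exact h1.trans (by gcongr)
        calc (fderiv ℝ f (γ t) (y - x)) ^ 2 = ‖fderiv ℝ f (γ t) (y - x)‖ ^ 2 := by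
              rw [Real.norm_eq_abs, sq_abs]
          _ ≤ (D * ‖fderiv ℝ f (γ t)‖) ^ 2 := by gcongr
          _ = D ^ 2 * ‖fderiv ℝ f (γ t)‖ ^ 2 := by ring
    _ = _ := by rw [integral_const_mul]; ring

lemma cell_poincare {n : ℕ} (hn : 1 ≤ n) {K : Set (Eu n)} (hKm : MeasurableSet K)
    (hKc : Convex ℝ K) (hKb : Bornology.IsBounded K) (hK0 : volume K ≠ 0) (D : ℝ)
    (hD : ∀ x ∈ K, ∀ y ∈ K, ‖x - y‖ ≤ D) (f : Eu n → ℝ) (hf : ContDiff ℝ (⊤ : ℕ∞) f)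
    (ε : ℝ) (hε0 : 0 ≤ ε) (hε : ε ≤ 1 / (2 * n)) :
    ∫⁻ x in K, ENNReal.ofReal ((f x - avg K ε f x) ^ 2) ≤
      ENNReal.ofReal (2 * ε ^ 2 * D ^ 2) * ∫⁻ x in K, ENNReal.ofReal (‖fderiv ℝ f x‖ ^ 2) := by
  have hc : Continuous (fderiv ℝ f) := hf.continuous_fderiv (by simp)
  have hfc : Continuous f := hf.continuous
  have hKt := volume_ne_top hKb
  have : IsFiniteMeasure (volume.restrict K) := ⟨by simpa using hKt.lt_top⟩
  set M := volume.real K with hM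
  have hMpos : 0 < M := by
    rw [hM, measureReal_def]; exact ENNReal.toReal_pos hK0 hKt
  set G : Eu n → ENNReal := fun x => ENNReal.ofReal (‖fderiv ℝ f x‖ ^ 2) with hG
  have hpt : ∀ x ∈ K, ENNReal.ofReal ((f x - avg K ε f x) ^ 2) ≤
      ENNReal.ofReal (M⁻¹ * (ε * D ^ 2)) *
        ∫⁻ y in K, ∫⁻ t in Set.Ioc 0 ε, G ((1 - t) • x + t • y) := by
    intro x hx
    have hi : IntegrableOn (fun y => f ((1 - ε) • x + ε • y)) K :=
      integrableOn_of_bounded hKb (by fun_prop)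
    have hi1 : IntegrableOn (fun y => f x - f ((1 - ε) • x + ε • y)) K :=
      integrableOn_of_bounded hKb (by fun_prop)
    have hi2 : IntegrableOn (fun y => (f x - f ((1 - ε) • x + ε • y)) ^ 2) K :=
      integrableOn_of_bounded hKb (by fun_prop)
    have e1 : f x - avg K ε f x = M⁻¹ * ∫ y in K, (f x - f ((1 - ε) • x + ε • y)) := by
      rw [integral_sub (integrable_const _) hi, integral_const, avg, mul_sub]
      congr 1
      simp only [smul_eq_mul, measureReal_restrict_apply_univ]
      rw [← hM]; field_simp
    have cs := cauchy_schwarz (volume.restrict K) _ hi1 hi2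
    rw [measureReal_restrict_apply_univ, ← hM] at cs
    have e2 : (f x - avg K ε f x) ^ 2 ≤ M⁻¹ * ∫ y in K, (f x - f ((1 - ε) • x + ε • y)) ^ 2 := by
      rw [e1, mul_pow]
      calc M⁻¹ ^ 2 * (∫ y in K, (f x - f ((1 - ε) • x + ε • y))) ^ 2
          ≤ M⁻¹ ^ 2 * (M * ∫ y in K, (f x - f ((1 - ε) • x + ε • y)) ^ 2) := by gcongr
        _ = _ := by field_simp
    refine (ENNReal.ofReal_le_ofReal e2).trans ?_
    rw [ENNReal.ofReal_mul (by positivity), ENNReal.ofReal_mul (by positivity), mul_assoc]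
    gcongr
    rw [ofReal_integral_eq_lintegral_ofReal hi2 (Filter.Eventually.of_forall fun y => sq_nonneg _),
      ← lintegral_const_mul' _ _ ENNReal.ofReal_ne_top]
    apply setLIntegral_mono' hKm
    intro y hy
    refine (ENNReal.ofReal_le_ofReal (ftc_bound f hf x y ε D hε0 (hD x hx y hy))).trans ?_
    rw [ENNReal.ofReal_mul (by positivity), ofReal_integral_eq_lintegral_ofReal]
    · apply Continuous.integrableOn_Ioc; fun_prop
    · exact Filter.Eventually.of_forall fun y => sq_nonneg _
  have hGm : Measurable G := by
    apply Measurable.ennreal_ofReal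
    apply Continuous.measurable; fun_prop
  calc ∫⁻ x in K, ENNReal.ofReal ((f x - avg K ε f x) ^ 2)
      ≤ ∫⁻ x in K, ENNReal.ofReal (M⁻¹ * (ε * D ^ 2)) *
        ∫⁻ y in K, ∫⁻ t in Set.Ioc 0 ε, G ((1 - t) • x + t • y) := setLIntegral_mono' hKm hpt
    _ = ENNReal.ofReal (M⁻¹ * (ε * D ^ 2)) *
        ∫⁻ x in K, ∫⁻ y in K, ∫⁻ t in Set.Ioc 0 ε, G ((1 - t) • x + t • y) := by
        rw [lintegral_const_mul' _ _ ENNReal.ofReal_ne_top]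
    _ = ENNReal.ofReal (M⁻¹ * (ε * D ^ 2)) *
        ∫⁻ y in K, ∫⁻ t in Set.Ioc 0 ε, ∫⁻ x in K, G ((1 - t) • x + t • y) := by
        congr 1
        rw [lintegral_lintegral_swap]
        · congr 1
          ext y
          rw [lintegral_lintegral_swap]
          apply Measurable.aemeasurable
          apply hGm.comp
          apply Continuous.measurable; fun_prop
        · apply Measurable.aemeasurable
          apply Measurable.lintegral_prod_right' (f := fun p : (Eu n × Eu n) × ℝ =>
            G ((1 - p.2) • p.1.1 + p.2 • p.1.2))
          apply hGm.comp
          apply Continuous.measurable; fun_prop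
    _ ≤ ENNReal.ofReal (M⁻¹ * (ε * D ^ 2)) *
        ∫⁻ y in K, ∫⁻ t in Set.Ioc 0 ε, 2 * ∫⁻ x in K, G x := by
        gcongr 1
        apply setLIntegral_mono' hKm
        intro y hy
        apply setLIntegral_mono' measurableSet_Ioc
        intro t ht
        exact lintegral_contract hn hKm hKc G y hy t ht.1.le (ht.2.trans hε)
    _ = ENNReal.ofReal (M⁻¹ * (ε * D ^ 2)) * ((2 * ∫⁻ x in K, G x) * ENNReal.ofReal ε *
          ENNReal.ofReal M) := by
        simp only [lintegral_const, Measure.restrict_apply_univ, Real.volume_Ioc, sub_zero]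
        rw [hM, measureReal_def, ENNReal.ofReal_toReal hKt]
    _ = ENNReal.ofReal (2 * ε ^ 2 * D ^ 2) * ∫⁻ x in K, G x := by
        have h22 : (2 : ENNReal) * ∫⁻ x in K, G x = ENNReal.ofReal 2 * ∫⁻ x in K, G x := by
          simp
        rw [h22]
        have : (2 * ε ^ 2 * D ^ 2) = M⁻¹ * (ε * D ^ 2) * 2 * ε * M := by field_simp
        have e3 : ENNReal.ofReal (M⁻¹ * (ε * D ^ 2) * 2 * ε * M) =
            ENNReal.ofReal (M⁻¹ * (ε * D ^ 2)) * ENNReal.ofReal 2 * ENNReal.ofReal ε *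
              ENNReal.ofReal M := by
          rw [ENNReal.ofReal_mul (q := M) (by positivity),
            ENNReal.ofReal_mul (q := ε) (by positivity),
            ENNReal.ofReal_mul (q := 2) (by positivity)]
        rw [this, e3]
        ring

lemma bessel_set {n : ℕ} {Ω : Set (Eu n)} {ι : Type*} [Fintype ι]
    (u : ι → Lp ℝ 2 (volume.restrict Ω)) (hu : Orthonormal ℝ u) (f : ι → Eu n → ℝ)
    (hf : ∀ j, (u j : Eu n → ℝ) =ᵐ[volume.restrict Ω] f j) (S : Set (Eu n)) (hS : MeasurableSet S)
    (hSΩ : S ⊆ Ω) (hSt : volume S ≠ ⊤) :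
    ∑ j, (∫ x in S, f j x) ^ 2 ≤ volume.real S := by
  have hr : (volume.restrict Ω) S = volume S := by
    rw [Measure.restrict_apply hS, Set.inter_eq_left.2 hSΩ]
  have hSt' : (volume.restrict Ω) S ≠ ⊤ := by rwa [hr]
  have h := hu.sum_inner_products_le (s := Finset.univ) (indicatorConstLp 2 hS hSt' (1 : ℝ))
  have e : ∀ j, ‖inner ℝ (u j) (indicatorConstLp 2 hS hSt' (1 : ℝ))‖ ^ 2 = (∫ x in S, f j x) ^ 2 := by
    intro j
    rw [real_inner_comm, L2.inner_indicatorConstLp_one, Real.norm_eq_abs, sq_abs]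
    congr 1
    rw [Measure.restrict_restrict hS, Set.inter_eq_left.2 hSΩ]
    apply integral_congr_ae
    exact ae_mono (Measure.restrict_mono hSΩ le_rfl) (hf j)
  simp_rw [e] at h
  refine h.trans (le_of_eq ?_)
  rw [norm_indicatorConstLp (by simp) (by simp)]
  simp only [norm_one, one_mul, ENNReal.toReal_ofNat]
  rw [← Real.sqrt_eq_rpow, Real.sq_sqrt measureReal_nonneg]
  simp [measureReal_def, hr]

lemma avg_bessel {n : ℕ} {Ω : Set (Eu n)} {ι : Type*} [Fintype ι]
    (u : ι → Lp ℝ 2 (volume.restrict Ω)) (hu : Orthonormal ℝ u) (f : ι → Eu n → ℝ)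
    (hf : ∀ j, (u j : Eu n → ℝ) =ᵐ[volume.restrict Ω] f j) {K : Set (Eu n)} (hKm : MeasurableSet K)
    (hKc : Convex ℝ K) (hKb : Bornology.IsBounded K) (hK0 : volume K ≠ 0) (hKΩ : K ⊆ Ω)
    (hfc : ∀ j, Continuous (f j)) (ε : ℝ) (hε0 : 0 < ε) (hε1 : ε ≤ 1) :
    ∑ j, ∫⁻ x in K, ENNReal.ofReal ((avg K ε (f j) x) ^ 2) ≤ ENNReal.ofReal ((ε ^ n)⁻¹) := by
  have hKt := volume_ne_top hKb
  set M := volume.real K with hM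
  have hMpos : 0 < M := by
    rw [hM, measureReal_def]; exact ENNReal.toReal_pos hK0 hKt
  rw [← lintegral_finsetSum]
  swap
  · intro j _
    exact ((measurable_avg K ε (f j) (hfc j)).pow_const 2).ennreal_ofReal
  have hpt : ∀ x ∈ K, ∑ j, ENNReal.ofReal ((avg K ε (f j) x) ^ 2) ≤
      ENNReal.ofReal ((ε ^ n)⁻¹ * M⁻¹) := by
    intro x hx
    rw [← ENNReal.ofReal_sum_of_nonneg fun j _ => sq_nonneg _]
    apply ENNReal.ofReal_le_ofReal
    set T : Eu n → Eu n := fun y => ε • y + (1 - ε) • x with hT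
    have hd := fun y (_ : y ∈ K) => hasFDeriv_aff ε ((1 - ε) • x) K y
    have hinj := injOn_aff ε hε0.ne' ((1 - ε) • x) K
    have hSm : MeasurableSet (T '' K) :=
      measurable_image_of_fderivWithin hKm hd hinj
    have hSK : T '' K ⊆ K := by
      rintro _ ⟨y, hy, rfl⟩
      exact hKc hy hx hε0.le (by linarith) (by ring)
    have hvol : volume.real (T '' K) = ε ^ n * M := by
      have h := lintegral_image_eq_lintegral_abs_det_fderiv_mul volume hKm hd hinj (fun _ => 1)
      simp only [det_aff, mul_one, lintegral_const, Measure.restrict_apply_univ, one_mul] at h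
      rw [measureReal_def, h, ENNReal.toReal_mul, ENNReal.toReal_ofReal (abs_nonneg _),
        abs_of_pos (by positivity)]
      rfl
    have hav : ∀ j, avg K ε (f j) x = M⁻¹ * ((ε ^ n)⁻¹ * ∫ z in T '' K, f j z) := by
      intro j
      rw [integral_image_eq_integral_abs_det_fderiv_smul volume hKm hd hinj]
      simp only [det_aff, smul_eq_mul]
      rw [integral_const_mul, abs_of_pos (by positivity), avg]
      simp only [add_comm (ε • _)]
      rw [← mul_assoc (ε ^ n)⁻¹, inv_mul_cancel₀ (by positivity), one_mul]
    have hb := bessel_set u hu f hf (T '' K) hSm (hSK.trans hKΩ)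
      (ne_top_of_le_ne_top hKt (measure_mono hSK))
    rw [hvol] at hb
    calc ∑ j, (avg K ε (f j) x) ^ 2 = (M⁻¹ * (ε ^ n)⁻¹) ^ 2 * ∑ j, (∫ z in T '' K, f j z) ^ 2 := by
          rw [Finset.mul_sum]
          refine Finset.sum_congr rfl fun j _ => ?_
          rw [hav]; ring
      _ ≤ (M⁻¹ * (ε ^ n)⁻¹) ^ 2 * (ε ^ n * M) := by gcongr
      _ = _ := by field_simp
  refine (setLIntegral_mono' hKm hpt).trans ?_
  rw [lintegral_const, Measure.restrict_apply_univ, ← ENNReal.ofReal_toReal hKt,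
    ← ENNReal.ofReal_mul (by positivity)]
  apply ENNReal.ofReal_le_ofReal
  rw [← measureReal_def, ← hM, mul_assoc, inv_mul_cancel₀ hMpos.ne', mul_one]

/-- admissible test spaces -/
def IsTest (n k : ℕ) (Ω : Set (Eu n)) (V : Submodule ℝ (Eu n → ℝ)) : Prop :=
  Module.finrank ℝ V = k + 1 ∧ (∀ f ∈ V, ContDiff ℝ (⊤ : ℕ∞) f) ∧
      ∀ f ∈ V, (∀ x ∈ Ω, f x = 0) → f = 0

lemma memLp_of_continuous {n : ℕ} {Ω : Set (Eu n)} (hb : Bornology.IsBounded Ω) {f : Eu n → ℝ}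
    (hf : Continuous f) : MemLp f 2 (volume.restrict Ω) := by
  rw [memLp_two_iff_integrable_sq hf.aestronglyMeasurable]
  exact integrableOn_of_bounded hb (hf.pow 2)

/-- the map from a test space to `L²` -/
noncomputable def toL2 {n k : ℕ} {Ω : Set (Eu n)} (hb : Bornology.IsBounded Ω)
    {V : Submodule ℝ (Eu n → ℝ)} (hV : IsTest n k Ω V) :
    V →ₗ[ℝ] Lp ℝ 2 (volume.restrict Ω) where
  toFun f := (memLp_of_continuous hb (hV.2.1 f.1 f.2).continuous).toLp f.1
  map_add' _ _ := rfl
  map_smul' _ _ := rfl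

lemma toL2_coe {n k : ℕ} {Ω : Set (Eu n)} (hb : Bornology.IsBounded Ω)
    {V : Submodule ℝ (Eu n → ℝ)} (hV : IsTest n k Ω V) (f : V) :
    (toL2 hb hV f : Eu n → ℝ) =ᵐ[volume.restrict Ω] f.1 :=
  MemLp.coeFn_toLp (memLp_of_continuous hb (hV.2.1 f.1 f.2).continuous)

lemma toL2_norm {n k : ℕ} {Ω : Set (Eu n)} (hb : Bornology.IsBounded Ω)
    {V : Submodule ℝ (Eu n → ℝ)} (hV : IsTest n k Ω V) (f : V) :
    ‖toL2 hb hV f‖ ^ 2 = ∫ x in Ω, f.1 x ^ 2 := by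
  rw [← real_inner_self_eq_norm_sq, L2.inner_def]
  apply integral_congr_ae
  filter_upwards [toL2_coe hb hV f] with x hx
  rw [hx]
  simp [sq]

lemma toL2_ker {n k : ℕ} {Ω : Set (Eu n)} (hb : Bornology.IsBounded Ω) (ho : IsOpen Ω)
    {V : Submodule ℝ (Eu n → ℝ)} (hV : IsTest n k Ω V) : (toL2 hb hV).ker = ⊥ := by
  rw [LinearMap.ker_eq_bot']
  intro f hf
  have h1 := toL2_coe hb hV f
  rw [hf] at h1
  have h2 : f.1 =ᵐ[volume.restrict Ω] (fun _ => (0 : ℝ)) :=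
    h1.symm.trans (Lp.coeFn_zero _ _ _)
  have h3 := Measure.eqOn_open_of_ae_eq h2 ho (hV.2.1 f.1 f.2).continuous.continuousOn
    continuousOn_const
  exact Subtype.ext (hV.2.2 f.1 f.2 fun x hx => h3 hx)

lemma denom_pos {n k : ℕ} {Ω : Set (Eu n)} (hb : Bornology.IsBounded Ω) (ho : IsOpen Ω)
    {V : Submodule ℝ (Eu n → ℝ)} (hV : IsTest n k Ω V) (f : Eu n → ℝ) (hf : f ∈ V) (h0 : f ≠ 0) :
    0 < ∫ x in Ω, f x ^ 2 := by
  have h := toL2_norm hb hV ⟨f, hf⟩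
  simp only at h
  rw [← h]
  have : toL2 hb hV ⟨f, hf⟩ ≠ 0 := by
    intro h1
    have h2 := LinearMap.ker_eq_bot'.1 (toL2_ker hb ho hV) _ h1
    exact h0 (congrArg Subtype.val h2)
  positivity

lemma rayleigh_bdd {n k : ℕ} {Ω : Set (Eu n)} (hb : Bornology.IsBounded Ω) (ho : IsOpen Ω)
    {V : Submodule ℝ (Eu n → ℝ)} (hV : IsTest n k Ω V) :
    BddAbove (Set.range fun f : {f : Eu n → ℝ // f ∈ V ∧ f ≠ 0} =>
      (∫ x in Ω, ‖fderiv ℝ f.1 x‖ ^ 2) / ∫ x in Ω, (f.1 x) ^ 2) := by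
  have hfin : FiniteDimensional ℝ V := Module.finite_of_finrank_pos (by rw [hV.1]; omega)
  let b := Module.finBasisOfFinrankEq ℝ V hV.1
  let T : (Fin (k + 1) → ℝ) →ₗ[ℝ] Lp ℝ 2 (volume.restrict Ω) :=
    (toL2 hb hV).comp b.equivFun.symm.toLinearMap
  have hTk : T.ker = ⊥ := by
    rw [LinearMap.ker_eq_bot]
    exact (LinearMap.ker_eq_bot.1 (toL2_ker hb ho hV)).comp b.equivFun.symm.injective
  obtain ⟨κ, hκ, hal⟩ := T.exists_antilipschitzWith hTk
  set C := ∫ x in Ω, (∑ i, ‖fderiv ℝ (b i).1 x‖) ^ 2 with hC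
  have hC0 : 0 ≤ C := integral_nonneg fun x => sq_nonneg _
  refine ⟨C * κ ^ 2, ?_⟩
  rintro _ ⟨⟨f, hf, hf0⟩, rfl⟩
  simp only
  have hpos := denom_pos hb ho hV f hf hf0
  rw [div_le_iff₀ hpos]
  set a := b.equivFun ⟨f, hf⟩ with ha
  have hTa : T a = toL2 hb hV ⟨f, hf⟩ := by
    simp [T, ha]
  have hn1 : ‖a‖ ≤ κ * ‖toL2 hb hV ⟨f, hf⟩‖ := by
    have := hal.le_mul_dist a 0
    simpa [hTa] using this
  have hn2 : ‖a‖ ^ 2 ≤ κ ^ 2 * ∫ x in Ω, f x ^ 2 := by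
    have h := toL2_norm hb hV ⟨f, hf⟩
    simp only at h
    rw [← h, ← mul_pow]
    gcongr
  have hfe : f = fun x => ∑ i, a i * (b i).1 x := by
    have h := b.sum_equivFun ⟨f, hf⟩
    have h' := congrArg Subtype.val h
    simp only at h'
    funext x
    rw [← ha] at h'
    conv_lhs => rw [← h']
    simp
  have hbs : ∀ i, ContDiff ℝ (⊤ : ℕ∞) (b i).1 := fun i => hV.2.1 _ (b i).2
  have hbd : ∀ i x, DifferentiableAt ℝ (b i).1 x := fun i x => (hbs i).differentiable (by simp) x
  have hbc : ∀ i, Continuous (fderiv ℝ (b i).1) := fun i => (hbs i).continuous_fderiv (by simp)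
  have hgr : ∀ x, ‖fderiv ℝ f x‖ ≤ ‖a‖ * ∑ i, ‖fderiv ℝ (b i).1 x‖ := by
    intro x
    have : fderiv ℝ f x = ∑ i, a i • fderiv ℝ (b i).1 x := by
      conv_lhs => rw [hfe]
      rw [fderiv_fun_sum fun i _ => (hbd i x).const_mul _]
      refine Finset.sum_congr rfl fun i _ => ?_
      rw [fderiv_const_mul (hbd i x)]
    rw [this, Finset.mul_sum]
    refine (norm_sum_le _ _).trans (Finset.sum_le_sum fun i _ => ?_)
    rw [norm_smul]
    gcongr
    exact norm_le_pi_norm a i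
  have hfc : Continuous (fderiv ℝ f) := (hV.2.1 f hf).continuous_fderiv (by simp)
  calc ∫ x in Ω, ‖fderiv ℝ f x‖ ^ 2 ≤ ∫ x in Ω, ‖a‖ ^ 2 * (∑ i, ‖fderiv ℝ (b i).1 x‖) ^ 2 := by
        refine integral_mono (integrableOn_of_bounded hb (by fun_prop))
          (integrableOn_of_bounded hb (by fun_prop)) fun x => ?_
        simp only
        rw [← mul_pow]
        gcongr
        exact hgr x
    _ = ‖a‖ ^ 2 * C := by rw [integral_const_mul]
    _ ≤ (κ ^ 2 * ∫ x in Ω, f x ^ 2) * C := by gcongr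
    _ = _ := by ring

lemma exists_good {n k : ℕ} (hn : 1 ≤ n) {Ω : Set (Eu n)} (hb : Bornology.IsBounded Ω)
    (ho : IsOpen Ω)
    {V : Submodule ℝ (Eu n → ℝ)} (hV : IsTest n k Ω V) {ι : Type*} [Fintype ι]
    (K : ι → Set (Eu n)) (hKm : ∀ i, MeasurableSet (K i)) (hKc : ∀ i, Convex ℝ (K i))
    (hKd : Pairwise (Function.onFun Disjoint K)) (hKu : ⋃ i, K i = Ω) (D : ℝ)
    (hD : ∀ i, ∀ x ∈ K i, ∀ y ∈ K i, ‖x - y‖ ≤ D)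
    (hcard : 4 * (Fintype.card ι * (2 * n) ^ n) ≤ k + 1) :
    ∃ f ∈ V, f ≠ 0 ∧ (∫ x in Ω, f x ^ 2) ≤ (2 * D ^ 2 / n ^ 2) * ∫ x in Ω, ‖fderiv ℝ f x‖ ^ 2 := by
  have hn' : (1 : ℝ) ≤ n := by exact_mod_cast hn
  have hfin : FiniteDimensional ℝ V := Module.finite_of_finrank_pos (by rw [hV.1]; omega)
  have hKΩ : ∀ i, K i ⊆ Ω := fun i => hKu ▸ Set.subset_iUnion K i
  have hKb : ∀ i, Bornology.IsBounded (K i) := fun i => hb.subset (hKΩ i)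
  set T := toL2 hb hV with hT
  have hinj : Function.Injective T := LinearMap.ker_eq_bot.1 (toL2_ker hb ho hV)
  have hrk : Module.finrank ℝ (LinearMap.range T) = k + 1 := by
    rw [LinearMap.finrank_range_of_inj hinj, hV.1]
  let ob := stdOrthonormalBasis ℝ (LinearMap.range T)
  let u : Fin (Module.finrank ℝ (LinearMap.range T)) → Lp ℝ 2 (volume.restrict Ω) :=
    fun j => (ob j).1
  have hu : Orthonormal ℝ u :=
    ob.orthonormal.comp_linearIsometry (LinearMap.range T).subtypeₗᵢ
  have hex : ∀ j, ∃ f : V, T f = u j := fun j => (ob j).2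
  choose F hF using hex
  have hFs : ∀ j, ContDiff ℝ (⊤ : ℕ∞) (F j).1 := fun j => hV.2.1 _ (F j).2
  have hae : ∀ j, (u j : Eu n → ℝ) =ᵐ[volume.restrict Ω] (F j).1 := by
    intro j
    rw [← hF]
    exact toL2_coe hb hV (F j)
  set ε : ℝ := 1 / (2 * n) with hε
  have hε0 : 0 < ε := by positivity
  have hε1 : ε ≤ 1 := by
    rw [hε, div_le_one (by positivity)]; linarith
  have hB : ∀ i, ∑ j, ∫⁻ x in K i, ENNReal.ofReal ((avg (K i) ε (F j).1 x) ^ 2) ≤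
      ENNReal.ofReal ((ε ^ n)⁻¹) := by
    intro i
    by_cases h0 : volume (K i) = 0
    · simp [setLIntegral_measure_zero _ _ h0]
    · exact avg_bessel u hu (fun j => (F j).1) hae (hKm i) (hKc i) (hKb i) h0 (hKΩ i)
        (fun j => (hFs j).continuous) ε hε0 hε1
  have hεn : (ε ^ n)⁻¹ = (2 * n : ℝ) ^ n := by
    rw [hε, one_div, inv_pow, inv_inv]
  have hBs : ∑ j, ∑ i, ∫⁻ x in K i, ENNReal.ofReal ((avg (K i) ε (F j).1 x) ^ 2) ≤
      ENNReal.ofReal ((k + 1) / 4) := by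
    rw [Finset.sum_comm]
    refine (Finset.sum_le_sum fun i _ => hB i).trans ?_
    rw [hεn, Finset.sum_const, Finset.card_univ, ← ENNReal.ofReal_nsmul]
    apply ENNReal.ofReal_le_ofReal
    have : (4 * (Fintype.card ι * (2 * n) ^ n) : ℝ) ≤ k + 1 := by exact_mod_cast hcard
    rw [nsmul_eq_mul]
    linarith
  obtain ⟨j, hj⟩ : ∃ j, ∑ i, ∫⁻ x in K i, ENNReal.ofReal ((avg (K i) ε (F j).1 x) ^ 2) ≤
      ENNReal.ofReal (1 / 4) := by
    by_contra! hcon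
    have hne : (Finset.univ : Finset (Fin (Module.finrank ℝ (LinearMap.range T)))).Nonempty := by
      rw [← Finset.card_pos, Finset.card_univ, Fintype.card_fin, hrk]; omega
    have := ENNReal.sum_lt_sum_of_nonempty hne (fun j _ => hcon j)
    have := this.trans_le hBs
    rw [Finset.sum_const, Finset.card_univ, Fintype.card_fin, hrk, ← ENNReal.ofReal_nsmul,
      nsmul_eq_mul] at this
    push_cast at this
    rw [mul_one_div] at this
    exact lt_irrefl _ this
  set f := (F j).1 with hf
  have hfs : ContDiff ℝ (⊤ : ℕ∞) f := hFs j
  have hfc : Continuous (fderiv ℝ f) := hfs.continuous_fderiv (by simp)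
  have hone : ∫ x in Ω, f x ^ 2 = 1 := by
    rw [hf, ← toL2_norm hb hV (F j), ← hT, hF, hu.1 j, one_pow]
  refine ⟨f, (F j).2, ?_, ?_⟩
  · intro h0
    rw [h0] at hone
    simp at hone
  have hsum : ∀ G : Eu n → ENNReal, ∫⁻ x in Ω, G x = ∑ i, ∫⁻ x in K i, G x := by
    intro G
    rw [← hKu, lintegral_iUnion hKm hKd, tsum_fintype]
  have hP : ∀ i, ∫⁻ x in K i, ENNReal.ofReal ((f x - avg (K i) ε f x) ^ 2) ≤
      ENNReal.ofReal (2 * ε ^ 2 * D ^ 2) * ∫⁻ x in K i, ENNReal.ofReal (‖fderiv ℝ f x‖ ^ 2) := by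
    intro i
    by_cases h0 : volume (K i) = 0
    · simp [setLIntegral_measure_zero _ _ h0]
    · exact cell_poincare hn (hKm i) (hKc i) (hKb i) h0 D (hD i) f hfs ε hε0.le le_rfl
  set I := ∫ x in Ω, ‖fderiv ℝ f x‖ ^ 2 with hI
  have hI0 : 0 ≤ I := integral_nonneg fun x => sq_nonneg _
  have hIl : ∫⁻ x in Ω, ENNReal.ofReal (‖fderiv ℝ f x‖ ^ 2) = ENNReal.ofReal I := by
    rw [hI, ofReal_integral_eq_lintegral_ofReal]
    · exact integrableOn_of_bounded hb (by fun_prop)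
    · exact Filter.Eventually.of_forall fun y => sq_nonneg _
  have h1l : ∫⁻ x in Ω, ENNReal.ofReal (f x ^ 2) = ENNReal.ofReal 1 := by
    rw [← hone, ofReal_integral_eq_lintegral_ofReal]
    · exact integrableOn_of_bounded hb (hfs.continuous.pow 2)
    · exact Filter.Eventually.of_forall fun y => sq_nonneg _
  have hmain : ENNReal.ofReal 1 ≤ ENNReal.ofReal (2 * (2 * ε ^ 2 * D ^ 2 * I) + 2 * (1 / 4)) := by
    rw [← h1l, hsum]
    have hstep : ∀ i, ∫⁻ x in K i, ENNReal.ofReal (f x ^ 2) ≤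
        ENNReal.ofReal 2 * (∫⁻ x in K i, ENNReal.ofReal ((f x - avg (K i) ε f x) ^ 2)) +
        ENNReal.ofReal 2 * ∫⁻ x in K i, ENNReal.ofReal ((avg (K i) ε f x) ^ 2) := by
      intro i
      have hm := measurable_avg (K i) ε f hfs.continuous
      rw [← lintegral_const_mul' _ _ ENNReal.ofReal_ne_top,
        ← lintegral_const_mul' _ _ ENNReal.ofReal_ne_top, ← lintegral_add_right]
      · apply lintegral_mono
        intro x
        simp only
        rw [← ENNReal.ofReal_mul (by norm_num), ← ENNReal.ofReal_mul (by norm_num),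
          ← ENNReal.ofReal_add (by positivity) (by positivity)]
        apply ENNReal.ofReal_le_ofReal
        nlinarith [sq_nonneg (f x - 2 * avg (K i) ε f x)]
      · exact ((hm.pow_const 2).ennreal_ofReal).const_mul _
    refine (Finset.sum_le_sum fun i _ => hstep i).trans ?_
    rw [Finset.sum_add_distrib, ← Finset.mul_sum, ← Finset.mul_sum,
      ENNReal.ofReal_add (by positivity) (by positivity), ENNReal.ofReal_mul (p := 2) (by norm_num),
      ENNReal.ofReal_mul (p := 2) (by norm_num)]
    gcongr
    refine (Finset.sum_le_sum fun i _ => hP i).trans ?_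
    rw [← Finset.mul_sum, ← hsum, hIl, ← ENNReal.ofReal_mul (by positivity)]
  have hreal := (ENNReal.ofReal_le_ofReal_iff (by positivity)).1 hmain
  rw [hone]
  have e : 2 * D ^ 2 / n ^ 2 * I = 2 * (4 * ε ^ 2 * D ^ 2 * I) := by
    rw [hε]; field_simp; ring
  rw [e]
  linarith

lemma eigenvalue_nonneg (n k : ℕ) (Ω : Set (Eu n)) : 0 ≤ neumannEigenvalue n k Ω := by
  apply Real.iInf_nonneg
  intro V
  apply Real.iSup_nonneg
  intro f
  exact div_nonneg (integral_nonneg fun x => sq_nonneg _) (integral_nonneg fun x => sq_nonneg _)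

lemma le_eigenvalue {n k : ℕ} {Ω : Set (Eu n)} (hb : Bornology.IsBounded Ω)
    (ho : IsOpen Ω) (hne : ∃ V, IsTest n k Ω V) (L : ℝ)
    (h : ∀ V, IsTest n k Ω V → ∃ f ∈ V, f ≠ 0 ∧
      L ≤ (∫ x in Ω, ‖fderiv ℝ f x‖ ^ 2) / ∫ x in Ω, f x ^ 2) :
    L ≤ neumannEigenvalue n k Ω := by
  obtain ⟨V0, hV0⟩ := hne
  have : Nonempty {V : Submodule ℝ (Eu n → ℝ) //
      Module.finrank ℝ V = k + 1 ∧ (∀ f ∈ V, ContDiff ℝ (⊤ : ℕ∞) f) ∧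
      ∀ f ∈ V, (∀ x ∈ Ω, f x = 0) → f = 0} := ⟨⟨V0, hV0⟩⟩
  apply le_ciInf
  rintro ⟨V, hV⟩
  obtain ⟨f, hf, h0, hL⟩ := h V hV
  exact hL.trans (le_ciSup (rayleigh_bdd hb ho hV) ⟨f, hf, h0⟩)

lemma eigenvalue_le {n k : ℕ} {Ω : Set (Eu n)} 
    (V : Submodule ℝ (Eu n → ℝ)) (hV : IsTest n k Ω V) (L : ℝ)
    (h : ∀ f ∈ V, f ≠ 0 → (∫ x in Ω, ‖fderiv ℝ f x‖ ^ 2) / (∫ x in Ω, f x ^ 2) ≤ L) :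
    neumannEigenvalue n k Ω ≤ L := by
  have hnt : ∃ f ∈ V, f ≠ 0 := by
    by_contra! hc
    have : V = ⊥ := (Submodule.eq_bot_iff V).2 hc
    have h1 := hV.1
    rw [this] at h1
    simp at h1
  obtain ⟨f0, hf0, h00⟩ := hnt
  have : Nonempty {f : Eu n → ℝ // f ∈ V ∧ f ≠ 0} := ⟨⟨f0, hf0, h00⟩⟩
  refine (ciInf_le ⟨0, ?_⟩ ⟨V, hV⟩).trans ?_
  · rintro _ ⟨W, rfl⟩
    apply Real.iSup_nonneg
    intro f
    exact div_nonneg (integral_nonneg fun x => sq_nonneg _) (integral_nonneg fun x => sq_nonneg _)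
  · apply ciSup_le
    rintro ⟨f, hf, h0⟩
    exact h f hf h0

lemma eigenvalue_mono {n k l : ℕ} (hlk : l ≤ k) {Ω : Set (Eu n)} (hb : Bornology.IsBounded Ω)
    (ho : IsOpen Ω) (hne : ∃ V, IsTest n k Ω V) :
    neumannEigenvalue n l Ω ≤ neumannEigenvalue n k Ω := by
  obtain ⟨V0, hV0⟩ := hne
  have : Nonempty {V : Submodule ℝ (Eu n → ℝ) //
      Module.finrank ℝ V = k + 1 ∧ (∀ f ∈ V, ContDiff ℝ (⊤ : ℕ∞) f) ∧
      ∀ f ∈ V, (∀ x ∈ Ω, f x = 0) → f = 0} := ⟨⟨V0, hV0⟩⟩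
  apply le_ciInf
  rintro ⟨V, hV⟩
  have hfin : FiniteDimensional ℝ V := Module.finite_of_finrank_pos (by rw [hV.1]; omega)
  let b := Module.finBasisOfFinrankEq ℝ V hV.1
  let w : Fin (l + 1) → (Eu n → ℝ) := fun i => (b (Fin.castLE (by omega) i)).1
  have hw : LinearIndependent ℝ w := by
    have h1 : LinearIndependent ℝ (fun i => (b i).1) :=
      b.linearIndependent.map' V.subtype (Submodule.ker_subtype V)
    exact h1.comp _ (Fin.castLE_injective (by omega))
  have hsub : Submodule.span ℝ (Set.range w) ≤ V := by
    rw [Submodule.span_le]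
    rintro _ ⟨i, rfl⟩
    exact (b _).2
  refine eigenvalue_le (Submodule.span ℝ (Set.range w)) ⟨?_, ?_, ?_⟩ _ ?_
  · rw [finrank_span_eq_card hw, Fintype.card_fin]
  · exact fun f hf => hV.2.1 f (hsub hf)
  · exact fun f hf => hV.2.2 f (hsub hf)
  · intro f hf h0
    exact le_ciSup (rayleigh_bdd hb ho hV) ⟨f, hsub hf, h0⟩

lemma smoothTransition_deriv_bound :
    ∃ C : ℝ, 0 < C ∧ ∀ t, ‖deriv Real.smoothTransition t‖ ≤ C := by
  have hc : Continuous (deriv Real.smoothTransition) :=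
    (Real.smoothTransition.contDiff (n := 1)).continuous_deriv (by simp)
  obtain ⟨C, hC⟩ := (isCompact_Icc (a := (-1 : ℝ)) (b := 2)).exists_bound_of_continuousOn
    hc.continuousOn
  refine ⟨max C 1, by positivity, fun t => ?_⟩
  by_cases h1 : t < 0
  · have : Real.smoothTransition =ᶠ[nhds t] fun _ => 0 := by
      filter_upwards [Iio_mem_nhds h1] with s hs
      exact Real.smoothTransition.zero_of_nonpos (le_of_lt hs)
    rw [this.deriv_eq]; simp
  by_cases h2 : 1 < t
  · have : Real.smoothTransition =ᶠ[nhds t] fun _ => 1 := by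
      filter_upwards [Ioi_mem_nhds h2] with s hs
      exact Real.smoothTransition.one_of_one_le (le_of_lt hs)
    rw [this.deriv_eq]; simp
  exact (hC t ⟨by linarith, by linarith⟩).trans (le_max_left _ _)

/-- bump function -/
noncomputable def bump {n : ℕ} (p : Eu n) (R : ℝ) (x : Eu n) : ℝ :=
  Real.smoothTransition (2 * n * (1 - ‖x - p‖ ^ 2 / R ^ 2))

lemma bump_contDiff {n : ℕ} (p : Eu n) (R : ℝ) : ContDiff ℝ (⊤ : ℕ∞) (bump p R) := by
  unfold bump
  apply Real.smoothTransition.contDiff.comp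
  apply ContDiff.mul contDiff_const
  apply ContDiff.sub contDiff_const
  apply ContDiff.div_const
  exact (contDiff_id.sub contDiff_const).norm_sq ℝ

lemma bump_nonneg {n : ℕ} (p : Eu n) (R : ℝ) (x : Eu n) : 0 ≤ bump p R x :=
  Real.smoothTransition.nonneg _

lemma bump_zero {n : ℕ} (p : Eu n) (R : ℝ) (hR : 0 < R) (x : Eu n) (hx : R ≤ ‖x - p‖) :
    bump p R x = 0 := by
  apply Real.smoothTransition.zero_of_nonpos
  have : 1 ≤ ‖x - p‖ ^ 2 / R ^ 2 := by
    rw [one_le_div (by positivity)]; gcongr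
  have hn : (0 : ℝ) ≤ 2 * n := by positivity
  nlinarith

lemma bump_one {n : ℕ} (hn : 1 ≤ n) (p : Eu n) (R : ℝ) (hR : 0 < R) (x : Eu n)
    (hx : ‖x - p‖ ≤ (1 - 1 / (2 * n)) * R) : bump p R x = 1 := by
  have hn' : (1 : ℝ) ≤ n := by exact_mod_cast hn
  apply Real.smoothTransition.one_of_one_le
  set t : ℝ := 1 / (2 * n) with ht
  have ht0 : 0 < t := by positivity
  have ht1 : t ≤ 1 := by rw [ht, div_le_one (by positivity)]; linarith
  have h1 : ‖x - p‖ ^ 2 / R ^ 2 ≤ 1 - t := by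
    rw [div_le_iff₀ (by positivity)]
    calc ‖x - p‖ ^ 2 ≤ ((1 - t) * R) ^ 2 := by gcongr
      _ = (1 - t) * ((1 - t) * R ^ 2) := by ring
      _ ≤ 1 * ((1 - t) * R ^ 2) := by
        have : 0 ≤ (1 - t) * R ^ 2 := mul_nonneg (by linarith) (by positivity)
        gcongr; linarith
      _ = _ := by ring
  have h2 : 2 * n * t = 1 := by rw [ht]; field_simp
  calc (1 : ℝ) = 2 * n * t := h2.symm
    _ ≤ _ := by gcongr; linarith

lemma bump_fderiv_zero {n : ℕ} (p : Eu n) (R : ℝ) (x : Eu n) (hx : bump p R x = 0) :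
    fderiv ℝ (bump p R) x = 0 := by
  apply IsLocalMin.fderiv_eq_zero
  exact Filter.Eventually.of_forall fun y => by rw [hx]; exact bump_nonneg p R y

lemma bump_fderiv_le {n : ℕ} (C : ℝ) (hC : 0 < C)
    (hCb : ∀ t, ‖deriv Real.smoothTransition t‖ ≤ C) (p : Eu n) (R : ℝ)
    (hR : 0 < R) (x : Eu n) : ‖fderiv ℝ (bump p R) x‖ ≤ 4 * C * n / R := by
  by_cases hx : R ≤ ‖x - p‖
  · rw [bump_fderiv_zero p R x (bump_zero p R hR x hx)]
    simp only [norm_zero]; positivity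
  push Not at hx
  obtain ⟨ψ, h1, hψ⟩ : ∃ ψ : Eu n →L[ℝ] ℝ,
      HasFDerivAt (fun x : Eu n => ‖x - p‖ ^ 2) ψ x ∧ ‖ψ‖ ≤ 2 * R := by
    refine ⟨_, ((hasFDerivAt_id x).sub_const p).norm_sq, ?_⟩
    rw [two_smul]
    refine (norm_add_le _ _).trans ?_
    rw [ContinuousLinearMap.comp_id, innerSL_apply_norm]
    simp only [id]
    linarith
  have h2 : HasFDerivAt (fun x : Eu n => 2 * (n : ℝ) * (1 - ‖x - p‖ ^ 2 / R ^ 2))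
      ((2 * (n : ℝ)) • -((R ^ 2)⁻¹ • ψ)) x := by
    have h3 := h1.const_mul (R ^ 2)⁻¹
    have h4 := (h3.const_sub 1).const_mul (2 * (n : ℝ))
    simpa only [div_eq_inv_mul] using h4
  have h5 : HasDerivAt Real.smoothTransition
      (deriv Real.smoothTransition (2 * n * (1 - ‖x - p‖ ^ 2 / R ^ 2)))
      (2 * n * (1 - ‖x - p‖ ^ 2 / R ^ 2)) :=
    ((Real.smoothTransition.contDiff (n := 1)).differentiable (by simp) _).hasDerivAt
  have h6 := h5.comp_hasFDerivAt x h2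
  have h7 : fderiv ℝ (bump p R) x = _ := h6.fderiv
  rw [h7, norm_smul]
  have h8 : ‖((2 * (n : ℝ)) • -((R ^ 2)⁻¹ • ψ))‖ ≤ 4 * n / R := by
    rw [norm_smul, norm_neg, norm_smul]
    calc ‖2 * (n : ℝ)‖ * (‖(R ^ 2)⁻¹‖ * ‖ψ‖)
        ≤ ‖2 * (n : ℝ)‖ * (‖(R ^ 2)⁻¹‖ * (2 * R)) := by gcongr
      _ = 2 * n * ((R ^ 2)⁻¹ * (2 * R)) := by
        rw [Real.norm_of_nonneg (by positivity), Real.norm_of_nonneg (by positivity)]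
      _ = 4 * n / R := by field_simp; ring
  calc _ ≤ C * (4 * n / R) := mul_le_mul (hCb _) h8 (norm_nonneg _) hC.le
    _ = _ := by ring

lemma bump_rayleigh {n : ℕ} (hn : 1 ≤ n) (C : ℝ) (hC : 0 < C)
    (hCb : ∀ t, ‖deriv Real.smoothTransition t‖ ≤ C) {Ω : Set (Eu n)} (ho : IsOpen Ω)
    (hcx : Convex ℝ Ω) (hb : Bornology.IsBounded Ω) (p : Eu n) (hp : p ∈ Ω) (R : ℝ)
    (hR : 0 < R) :
    ∫ x in Ω, ‖fderiv ℝ (bump p R) x‖ ^ 2 ≤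
      2 * (4 * C * n / R) ^ 2 * ∫ x in Ω, bump p R x ^ 2 := by
  have hn' : (1 : ℝ) ≤ n := by exact_mod_cast hn
  have hs := bump_contDiff p R
  have hfc : Continuous (fderiv ℝ (bump p R)) := hs.continuous_fderiv (by simp)
  set K := Ω ∩ Metric.ball p R with hK
  have hKm : MeasurableSet K := (ho.inter Metric.isOpen_ball).measurableSet
  have hKc : Convex ℝ K := hcx.inter (convex_ball p R)
  have hKb : Bornology.IsBounded K := hb.subset Set.inter_subset_left
  have hKΩ : K ⊆ Ω := Set.inter_subset_left
  have hpK : p ∈ K := ⟨hp, Metric.mem_ball_self hR⟩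
  have h1 : ∫ x in Ω, ‖fderiv ℝ (bump p R) x‖ ^ 2 = ∫ x in K, ‖fderiv ℝ (bump p R) x‖ ^ 2 := by
    apply setIntegral_eq_of_subset_of_forall_sdiff_eq_zero ho.measurableSet hKΩ
    rintro x ⟨hx, hxK⟩
    have : R ≤ ‖x - p‖ := by
      by_contra! hlt
      exact hxK ⟨hx, by rwa [Metric.mem_ball, dist_eq_norm]⟩
    rw [bump_fderiv_zero p R x (bump_zero p R hR x this)]; simp
  have h2 : ∫ x in K, ‖fderiv ℝ (bump p R) x‖ ^ 2 ≤ (4 * C * n / R) ^ 2 * volume.real K := by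
    have hle : ∫ x in K, ‖fderiv ℝ (bump p R) x‖ ^ 2 ≤ ∫ x in K, (4 * C * n / R) ^ 2 := by
      refine integral_mono (integrableOn_of_bounded hKb (by fun_prop))
        (integrableOn_of_bounded hKb (by fun_prop)) fun x => ?_
      simp only
      gcongr
      exact bump_fderiv_le C hC hCb p R hR x
    refine hle.trans (le_of_eq ?_)
    rw [integral_const, measureReal_restrict_apply_univ, smul_eq_mul, mul_comm]
  have hlc := lintegral_contract hn hKm hKc (fun x => ENNReal.ofReal (bump p R x ^ 2)) p hpK
    (1 / (2 * n)) (by positivity) le_rfl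
  have h3 : volume.real K ≤ 2 * ∫ x in Ω, bump p R x ^ 2 := by
    have e1 : ∫⁻ x in K, ENNReal.ofReal (bump p R
        ((1 - 1 / (2 * (n : ℝ))) • x + (1 / (2 * (n : ℝ))) • p) ^ 2) = volume K := by
      rw [setLIntegral_congr_fun (g := fun _ => 1) hKm, lintegral_const, one_mul,
        Measure.restrict_apply_univ]
      intro x hx
      have hxR : ‖x - p‖ ≤ R := by
        have := hx.2
        rw [Metric.mem_ball, dist_eq_norm] at this
        exact this.le
      have ht1 : (1 : ℝ) / (2 * n) ≤ 1 := by rw [div_le_one (by positivity)]; linarith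
      simp only
      rw [bump_one hn p R hR]
      · simp
      · have : (1 - 1 / (2 * (n : ℝ))) • x + (1 / (2 * (n : ℝ))) • p - p =
            (1 - 1 / (2 * (n : ℝ))) • (x - p) := by module
        rw [this, norm_smul, Real.norm_of_nonneg (by linarith)]
        have : 0 ≤ 1 - 1 / (2 * (n : ℝ)) := by linarith
        gcongr
    rw [e1] at hlc
    have e2 : ∫⁻ x in K, ENNReal.ofReal (bump p R x ^ 2) ≤
        ENNReal.ofReal (∫ x in Ω, bump p R x ^ 2) := by
      rw [ofReal_integral_eq_lintegral_ofReal]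
      · exact lintegral_mono_set hKΩ
      · exact integrableOn_of_bounded hb (hs.continuous.pow 2)
      · exact Filter.Eventually.of_forall fun y => sq_nonneg _
    have hI0 : 0 ≤ ∫ x in Ω, bump p R x ^ 2 := integral_nonneg fun x => sq_nonneg _
    have e3 : volume K ≤ ENNReal.ofReal (2 * ∫ x in Ω, bump p R x ^ 2) := by
      rw [ENNReal.ofReal_mul (by norm_num)]
      refine hlc.trans ?_
      rw [ENNReal.ofReal_ofNat]
      gcongr
    rw [measureReal_def]
    exact ENNReal.toReal_le_of_le_ofReal (by positivity) e3
  rw [h1]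
  refine h2.trans ?_
  calc (4 * C * n / R) ^ 2 * volume.real K
      ≤ (4 * C * n / R) ^ 2 * (2 * ∫ x in Ω, bump p R x ^ 2) := by gcongr
    _ = _ := by ring

lemma upper_bound {n l : ℕ} (hn : 1 ≤ n) (C : ℝ) (hC : 0 < C)
    (hCb : ∀ t, ‖deriv Real.smoothTransition t‖ ≤ C) {Ω : Set (Eu n)} (ho : IsOpen Ω)
    (hcx : Convex ℝ Ω) (hb : Bornology.IsBounded Ω) (p : Fin (l + 1) → Eu n) (hp : ∀ i, p i ∈ Ω)
    (h : ℝ) (hh : 0 < h) (hsep : ∀ i j, i ≠ j → h ≤ ‖p i - p j‖) :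
    (∃ V, IsTest n l Ω V) ∧ neumannEigenvalue n l Ω ≤ 2 * (8 * C * n / h) ^ 2 := by
  set R := h / 2 with hR
  have hR0 : 0 < R := by positivity
  set φ : Fin (l + 1) → Eu n → ℝ := fun i => bump (p i) R with hφ
  have hdisj : ∀ x i j, i ≠ j → φ i x ≠ 0 → φ j x = 0 := by
    intro x i j hij hi
    apply bump_zero _ _ hR0
    by_contra! hlt
    have h1 : ‖x - p i‖ < R := by
      by_contra! hge
      exact hi (bump_zero _ _ hR0 _ hge)
    have h2 := hsep i j hij
    have h3 : ‖p i - p j‖ ≤ ‖x - p j‖ + ‖x - p i‖ := by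
      have : p i - p j = (x - p j) - (x - p i) := by abel
      rw [this]; exact norm_sub_le _ _
    linarith
  have hself : ∀ i, φ i (p i) = 1 := by
    intro i
    apply bump_one hn _ _ hR0
    have hn' : (1 : ℝ) ≤ n := by exact_mod_cast hn
    have ht1 : (1 : ℝ) / (2 * n) ≤ 1 := by rw [div_le_one (by positivity)]; linarith
    simp only [sub_self, norm_zero]
    exact mul_nonneg (by linarith) hR0.le
  have hφs : ∀ i, ContDiff ℝ (⊤ : ℕ∞) (φ i) := fun i => bump_contDiff _ _
  have hφd : ∀ i x, DifferentiableAt ℝ (φ i) x := fun i x => (hφs i).differentiable (by simp) x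
  have hφc : ∀ i, Continuous (fderiv ℝ (φ i)) := fun i => (hφs i).continuous_fderiv (by simp)
  have hcross : ∀ i j, i ≠ j → φ i (p j) = 0 := by
    intro i j hij
    exact hdisj (p j) j i hij.symm (by rw [hself]; norm_num)
  have hval : ∀ (a : Fin (l + 1) → ℝ) j, (∑ i, a i • φ i) (p j) = a j := by
    intro a j
    rw [Finset.sum_apply, Finset.sum_eq_single j]
    · simp [hself]
    · intro i _ hij
      simp [hcross i j hij]
    · simp
  have hli : LinearIndependent ℝ φ := by
    rw [Fintype.linearIndependent_iff]
    intro a ha j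
    rw [← hval a j, ha]; rfl
  set V := Submodule.span ℝ (Set.range φ) with hV
  have hform : ∀ f ∈ V, ∃ a : Fin (l + 1) → ℝ, ∑ i, a i • φ i = f := fun f hf =>
    (Submodule.mem_span_range_iff_exists_fun ℝ).1 hf
  have hT : IsTest n l Ω V := by
    refine ⟨?_, ?_, ?_⟩
    · rw [hV, finrank_span_eq_card hli, Fintype.card_fin]
    · intro f hf
      obtain ⟨a, rfl⟩ := hform f hf
      have : (∑ i, a i • φ i) = fun x => ∑ i, a i * φ i x := by
        funext x; simp
      rw [this]
      exact ContDiff.sum fun i _ => contDiff_const.mul (hφs i)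
    · intro f hf h0
      obtain ⟨a, rfl⟩ := hform f hf
      have : ∀ j, a j = 0 := fun j => by rw [← hval a j]; exact h0 _ (hp j)
      simp [this]
  refine ⟨⟨V, hT⟩, eigenvalue_le V hT _ ?_⟩
  intro f hf hf0
  rw [div_le_iff₀ (denom_pos hb ho hT f hf hf0)]
  obtain ⟨a, rfl⟩ := hform f hf
  have hfe : (∑ i, a i • φ i) = fun x => ∑ i, a i * φ i x := by
    funext x; simp
  have hsq : ∀ x, (∑ i, a i • φ i) x ^ 2 = ∑ i, a i ^ 2 * φ i x ^ 2 := by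
    intro x
    rw [hfe]
    by_cases hx : ∃ i, φ i x ≠ 0
    · obtain ⟨i, hi⟩ := hx
      simp only
      rw [Finset.sum_eq_single i, Finset.sum_eq_single i, mul_pow]
      · intro j _ hj; rw [hdisj x i j hj.symm hi]; ring
      · simp
      · intro j _ hj; rw [hdisj x i j hj.symm hi]; ring
      · simp
    · push Not at hx
      simp [hx]
  have hgr : ∀ x, ‖fderiv ℝ (∑ i, a i • φ i) x‖ ^ 2 = ∑ i, a i ^ 2 * ‖fderiv ℝ (φ i) x‖ ^ 2 := by
    intro x
    have : fderiv ℝ (∑ i, a i • φ i) x = ∑ i, a i • fderiv ℝ (φ i) x := by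
      rw [hfe, fderiv_fun_sum fun i _ => (hφd i x).const_mul _]
      refine Finset.sum_congr rfl fun i _ => ?_
      rw [fderiv_const_mul (hφd i x)]
    rw [this]
    have hz : ∀ j, φ j x = 0 → fderiv ℝ (φ j) x = 0 := fun j hj => bump_fderiv_zero _ _ x hj
    by_cases hx : ∃ i, φ i x ≠ 0
    · obtain ⟨i, hi⟩ := hx
      rw [Finset.sum_eq_single i, Finset.sum_eq_single i, norm_smul, mul_pow, Real.norm_eq_abs,
        sq_abs]
      · intro j _ hj; rw [hz j (hdisj x i j hj.symm hi)]; simp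
      · simp
      · intro j _ hj; rw [hz j (hdisj x i j hj.symm hi)]; simp
      · simp
    · push Not at hx
      simp [fun j => hz j (hx j)]
  simp_rw [hsq, hgr]
  rw [integral_finsetSum, integral_finsetSum, Finset.mul_sum]
  · refine Finset.sum_le_sum fun i _ => ?_
    rw [integral_const_mul, integral_const_mul]
    have hbr := bump_rayleigh hn C hC hCb ho hcx hb (p i) (hp i) R hR0
    have e : 4 * C * n / R = 8 * C * n / h := by rw [hR]; field_simp; norm_num
    rw [e] at hbr
    calc a i ^ 2 * ∫ x in Ω, ‖fderiv ℝ (φ i) x‖ ^ 2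
        ≤ a i ^ 2 * (2 * (8 * C * n / h) ^ 2 * ∫ x in Ω, φ i x ^ 2) := by gcongr
      _ = _ := by ring
  · intro i _
    have := (hφs i).continuous
    exact integrableOn_of_bounded hb (by fun_prop)
  · intro i _
    have := hφc i
    exact integrableOn_of_bounded hb (by fun_prop)

/-- index of the grid cube of side `h` containing `x` -/
noncomputable def cell {n : ℕ} (h : ℝ) (x : Eu n) : Fin n → ℤ := fun i => ⌊x i / h⌋

lemma coord_le {n : ℕ} (x : Eu n) (i : Fin n) : |x i| ≤ ‖x‖ := by
  simpa using PiLp.norm_apply_le x i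

lemma cell_finite {n : ℕ} {Ω : Set (Eu n)} (hb : Bornology.IsBounded Ω) (h : ℝ) (hh : 0 < h) :
    (cell h '' Ω).Finite := by
  obtain ⟨B, hB⟩ := hb.exists_norm_le
  apply (Set.finite_Icc (fun _ : Fin n => ⌊-B / h⌋) (fun _ => ⌊B / h⌋)).subset
  rintro _ ⟨x, hx, rfl⟩
  have := fun i => abs_le.1 ((coord_le x i).trans (hB x hx))
  constructor
  · intro i
    apply Int.floor_le_floor
    have := (this i).1
    gcongr
  · intro i
    apply Int.floor_le_floor
    have := (this i).2
    gcongr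

/-- the number of cubes meeting `Ω` -/
noncomputable def numCells {n : ℕ} (Ω : Set (Eu n)) (h : ℝ) : ℕ := (cell h '' Ω).ncard

lemma numCells_large {n : ℕ} {Ω : Set (Eu n)} (hb : Bornology.IsBounded Ω) :
    ∃ h : ℝ, 0 < h ∧ numCells Ω h ≤ 2 ^ n := by
  obtain ⟨B, hB⟩ := hb.exists_norm_le
  refine ⟨|B| + 1, by positivity, ?_⟩
  have hsub : cell (|B| + 1) '' Ω ⊆ (Fintype.piFinset fun _ : Fin n => ({-1, 0} : Finset ℤ)) := by
    rintro _ ⟨x, hx, rfl⟩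
    simp only [Finset.mem_coe, Fintype.mem_piFinset]
    intro i
    have h1 := abs_le.1 (((coord_le x i).trans (hB x hx)).trans (le_abs_self B))
    have hpos : 0 < |B| + 1 := by positivity
    have h2 : -1 ≤ cell (|B| + 1) x i := by
      apply Int.le_floor.2
      rw [le_div_iff₀ hpos]; push_cast; linarith [h1.1]
    have h3 : cell (|B| + 1) x i < 1 := by
      apply Int.floor_lt.2
      rw [div_lt_iff₀ hpos]; push_cast; linarith [h1.2]
    simp only [Finset.mem_insert, Finset.mem_singleton]
    omega
  refine (Set.ncard_le_ncard hsub (Finset.finite_toSet _)).trans ?_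
  rw [Set.ncard_coe_finset, Fintype.card_piFinset]
  simp

lemma numCells_refine {n : ℕ} {Ω : Set (Eu n)} (hb : Bornology.IsBounded Ω) (h : ℝ) (hh : 0 < h)
    (m : ℕ) (hm : 1 ≤ m) : numCells Ω (h / m) ≤ m ^ n * numCells Ω h := by
  have hm' : (0 : ℝ) < m := by exact_mod_cast hm
  set S : Set ((Fin n → ℤ) × (Fin n → Fin m)) := (cell h '' Ω) ×ˢ Set.univ with hS
  have hSf : S.Finite := (cell_finite hb h hh).prod Set.finite_univ
  set g : (Fin n → ℤ) × (Fin n → Fin m) → (Fin n → ℤ) :=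
    fun q i => m * q.1 i + ((q.2 i : ℕ) : ℤ) with hg
  have hsub : cell (h / m) '' Ω ⊆ g '' S := by
    rintro _ ⟨x, hx, rfl⟩
    have h1 : ∀ i, (m : ℤ) * cell h x i ≤ cell (h / m) x i := by
      intro i
      apply Int.le_floor.2
      have : ((cell h x i : ℤ) : ℝ) ≤ x i / h := Int.floor_le _
      push_cast
      calc (m : ℝ) * (cell h x i : ℤ) ≤ m * (x i / h) := by gcongr
        _ = _ := by field_simp
    have h2 : ∀ i, cell (h / m) x i < m * cell h x i + m := by
      intro i
      apply Int.floor_lt.2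
      have : x i / h < (cell h x i : ℤ) + 1 := Int.lt_floor_add_one _
      push_cast
      calc x i / (h / m) = m * (x i / h) := by field_simp
        _ < m * ((cell h x i : ℤ) + 1) := by gcongr
        _ = _ := by ring
    refine ⟨(cell h x, fun i => ⟨(cell (h / m) x i - m * cell h x i).toNat, ?_⟩),
      ⟨⟨x, hx, rfl⟩, trivial⟩, ?_⟩
    · have := h1 i; have := h2 i; omega
    · funext i
      have := h1 i
      simp only [hg]
      rw [Int.toNat_of_nonneg (by omega)]
      ring
  unfold numCells
  refine (Set.ncard_le_ncard hsub (hSf.image _)).trans ?_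
  refine (Set.ncard_image_le hSf).trans ?_
  rw [hS, Set.ncard_prod, Set.ncard_univ, Nat.card_eq_fintype_card]
  simp [mul_comm]

lemma cell_diam {n : ℕ} (h : ℝ) (hh : 0 < h) (x y : Eu n) (hxy : cell h x = cell h y) :
    ‖x - y‖ ≤ Real.sqrt n * h := by
  rw [EuclideanSpace.norm_eq, ← Real.sqrt_sq hh.le, ← Real.sqrt_mul (by positivity)]
  apply Real.sqrt_le_sqrt
  have : ∀ i ∈ (Finset.univ : Finset (Fin n)), ‖(x - y) i‖ ^ 2 ≤ h ^ 2 := by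
    intro i _
    have e : ⌊x i / h⌋ = ⌊y i / h⌋ := congrFun hxy i
    have h1 := Int.abs_sub_lt_one_of_floor_eq_floor e
    have h2 : ‖(x - y) i‖ ≤ h := by
      rw [PiLp.sub_apply, Real.norm_eq_abs]
      rw [← sub_div, abs_div, abs_of_pos hh, div_lt_one hh] at h1
      exact h1.le
    gcongr
  refine (Finset.sum_le_sum this).trans ?_
  simp

lemma numCells_small {n : ℕ} (hn : 1 ≤ n) {Ω : Set (Eu n)} (ho : IsOpen Ω)
    (hb : Bornology.IsBounded Ω) (hne : Ω.Nonempty) (M : ℕ) :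
    ∀ᶠ h in nhdsWithin (0 : ℝ) (Set.Ioi 0), M ≤ numCells Ω h := by
  have : Nonempty (Fin n) := ⟨⟨0, hn⟩⟩
  obtain ⟨x0, hx0⟩ := hne
  have hinf : Ω.Infinite := infinite_of_mem_nhds x0 (ho.mem_nhds hx0)
  obtain ⟨t, htΩ, htc⟩ := hinf.exists_subset_card_eq M
  have hpair : ∀ᶠ h in nhdsWithin (0 : ℝ) (Set.Ioi 0), ∀ q ∈ t ×ˢ t, q.1 ≠ q.2 →
      Real.sqrt n * h < ‖q.1 - q.2‖ := by
    rw [Filter.eventually_all_finset]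
    intro q _
    by_cases hq : q.1 = q.2
    · simp [hq]
    · have hc : Filter.Tendsto (fun h : ℝ => Real.sqrt n * h) (nhdsWithin 0 (Set.Ioi 0))
          (nhds (Real.sqrt n * 0)) :=
        ((continuous_const.mul continuous_id).tendsto 0).mono_left nhdsWithin_le_nhds
      rw [mul_zero] at hc
      have hp : 0 < ‖q.1 - q.2‖ := norm_pos_iff.2 (sub_ne_zero.2 hq)
      filter_upwards [hc.eventually (gt_mem_nhds hp)] with h hh _
      exact hh
  filter_upwards [hpair, self_mem_nhdsWithin] with h hp hh
  have hinj : Set.InjOn (cell h) (t : Set (Eu n)) := by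
    intro x hx y hy hxy
    by_contra hne
    have h1 := hp (x, y) (Finset.mem_product.2 ⟨hx, hy⟩) hne
    have h2 := cell_diam h hh x y hxy
    simp only at h1
    linarith
  have h1 : (cell h '' (t : Set (Eu n))).ncard = M := by
    rw [Set.ncard_image_of_injOn hinj, Set.ncard_coe_finset, htc]
  rw [← h1]
  exact Set.ncard_le_ncard (Set.image_mono htΩ) (cell_finite hb h hh)

lemma packing {n l : ℕ} {Ω : Set (Eu n)}
    (hb : Bornology.IsBounded Ω) (h : ℝ) (hh : 0 < h) (hN : 2 ^ n * l < numCells Ω h) :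
    ∃ p : Fin (l + 1) → Eu n, (∀ i, p i ∈ Ω) ∧ ∀ i j, i ≠ j → h ≤ ‖p i - p j‖ := by
  classical
  set s := (cell_finite hb h hh).toFinset with hs
  have hsc : s.card = numCells Ω h := by
    rw [numCells, Set.ncard_eq_toFinset_card _ (cell_finite hb h hh)]
  obtain ⟨y, -, hy⟩ := Finset.exists_lt_card_fiber_of_mul_lt_card_of_maps_to
    (s := s) (t := (Finset.univ : Finset (Fin n → Bool))) (n := l)
    (f := fun v i => decide (v i % 2 = 0)) (fun _ _ => Finset.mem_univ _)
    (by rw [hsc]; simpa using hN)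
  obtain ⟨t, ht, htc⟩ := Finset.exists_subset_card_eq (Nat.succ_le_of_lt hy)
  let e := (t.equivFinOfCardEq htc).symm
  have hmem : ∀ i, ∃ x ∈ Ω, cell h x = (e i).1 := by
    intro i
    have := (Finset.mem_filter.1 (ht (e i).2)).1
    rw [hs, Set.Finite.mem_toFinset] at this
    exact this
  choose p hpΩ hp using hmem
  refine ⟨p, hpΩ, ?_⟩
  have key : ∀ i j c, cell h (p j) c + 2 ≤ cell h (p i) c → h ≤ ‖p i - p j‖ := by
    intro i j c hc
    have h1 : ((cell h (p i) c : ℤ) : ℝ) ≤ p i c / h := Int.floor_le _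
    have h2 : p j c / h < ((cell h (p j) c : ℤ) : ℝ) + 1 := Int.lt_floor_add_one _
    have h3 : ((cell h (p j) c : ℤ) : ℝ) + 2 ≤ ((cell h (p i) c : ℤ) : ℝ) := by exact_mod_cast hc
    have h4 : 1 ≤ (p i c - p j c) / h := by rw [sub_div]; linarith
    rw [one_le_div hh] at h4
    calc h ≤ p i c - p j c := h4
      _ ≤ |(p i - p j) c| := by rw [PiLp.sub_apply]; exact le_abs_self _
      _ ≤ _ := coord_le _ _
  intro i j hij
  have hne : cell h (p i) ≠ cell h (p j) := by
    rw [hp, hp]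
    intro h0
    exact hij (e.injective (Subtype.ext h0))
  obtain ⟨c, hc⟩ := Function.ne_iff.1 hne
  have hpar : ∀ i, decide (cell h (p i) c % 2 = 0) = y c := by
    intro i
    have := (Finset.mem_filter.1 (ht (e i).2)).2
    rw [hp]
    exact congrFun this c
  have hpp : (cell h (p i) c % 2 = 0) ↔ (cell h (p j) c % 2 = 0) := by
    have := (hpar i).trans (hpar j).symm
    simpa using this
  rcases lt_or_gt_of_ne hc with h1 | h1
  · rw [norm_sub_rev]
    exact key j i c (by omega)
  · exact key i j c (by omega)

lemma lower_bound {n k : ℕ} (hn : 1 ≤ n) {Ω : Set (Eu n)} (ho : IsOpen Ω)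
    (hcx : Convex ℝ Ω) (hb : Bornology.IsBounded Ω) (hne : ∃ V, IsTest n k Ω V)
    (h : ℝ) (hh : 0 < h) (hcard : 4 * (numCells Ω h * (2 * n) ^ n) ≤ k + 1) :
    n / (2 * h ^ 2) ≤ neumannEigenvalue n k Ω := by
  have hn' : (1 : ℝ) ≤ n := by exact_mod_cast hn
  apply le_eigenvalue hb ho hne
  intro V hV
  have hfin := cell_finite hb h hh
  have : Fintype (cell h '' Ω) := hfin.fintype
  let K : (cell h '' Ω) → Set (Eu n) := fun v => Ω ∩ {x | cell h x = v.1}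
  have hset : ∀ v : Fin n → ℤ, {x : Eu n | cell h x = v} =
      ⋂ i, {x : Eu n | (v i : ℝ) * h ≤ x i ∧ x i < (v i + 1) * h} := by
    intro v
    ext x
    simp only [Set.mem_setOf_eq, Set.mem_iInter, funext_iff]
    refine forall_congr' fun i => ?_
    unfold cell
    rw [Int.floor_eq_iff, le_div_iff₀ hh, div_lt_iff₀ hh]
  have hKm : ∀ v, MeasurableSet (K v) := by
    intro v
    apply ho.measurableSet.inter
    rw [hset]
    apply MeasurableSet.iInter
    intro i
    have hm : Measurable fun x : Eu n => x i := by fun_prop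
    exact (measurableSet_le measurable_const hm).inter (measurableSet_lt hm measurable_const)
  have hKc : ∀ v, Convex ℝ (K v) := by
    intro v
    apply hcx.inter
    rw [hset]
    apply convex_iInter
    intro i
    have hl : IsLinearMap ℝ fun x : Eu n => x i := ⟨fun _ _ => rfl, fun _ _ => rfl⟩
    exact (convex_halfSpace_ge hl _).inter (convex_halfSpace_lt hl _)
  have hKd : Pairwise (Function.onFun Disjoint K) := by
    intro v w hvw
    apply Set.disjoint_left.2
    rintro x ⟨_, hx⟩ ⟨_, hx'⟩
    exact hvw (Subtype.ext (hx.symm.trans hx'))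
  have hKu : ⋃ v, K v = Ω := by
    ext x
    simp only [Set.mem_iUnion, K]
    constructor
    · rintro ⟨v, hx, _⟩; exact hx
    · intro hx
      exact ⟨⟨cell h x, x, hx, rfl⟩, hx, rfl⟩
  have hKD : ∀ v, ∀ x ∈ K v, ∀ y ∈ K v, ‖x - y‖ ≤ Real.sqrt n * h :=
    fun v x hx y hy => cell_diam h hh x y (hx.2.trans hy.2.symm)
  have hcard' : 4 * (Fintype.card (cell h '' Ω) * (2 * n) ^ n) ≤ k + 1 := by
    have e : Fintype.card (cell h '' Ω) = numCells Ω h := by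
      rw [numCells, ← Nat.card_coe_set_eq, Nat.card_eq_fintype_card]
    rw [e]; exact hcard
  obtain ⟨f, hf, hf0, hle⟩ := exists_good hn hb ho hV K hKm hKc hKd hKu
    (Real.sqrt n * h) hKD hcard'
  refine ⟨f, hf, hf0, ?_⟩
  rw [le_div_iff₀ (denom_pos hb ho hV f hf hf0)]
  rw [mul_pow, Real.sq_sqrt (by positivity)] at hle
  calc n / (2 * h ^ 2) * ∫ x in Ω, f x ^ 2
      ≤ n / (2 * h ^ 2) * (2 * (n * h ^ 2) / n ^ 2 * ∫ x in Ω, ‖fderiv ℝ f x‖ ^ 2) := by gcongr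
    _ = _ := by field_simp

lemma exists_scale {n l : ℕ} (hn : 1 ≤ n) (hl : 1 ≤ l) {Ω : Set (Eu n)} (ho : IsOpen Ω)
    (hb : Bornology.IsBounded Ω) (hne : Ω.Nonempty) :
    ∃ h : ℝ, 0 < h ∧ 2 ^ n * l < numCells Ω h ∧ numCells Ω h ≤ 4 ^ n * l := by
  classical
  obtain ⟨h0, hh0, hN0⟩ := numCells_large hb
  have hex : ∃ j : ℕ, 2 ^ n * l < numCells Ω (h0 / 2 ^ j) := by
    have ht : Filter.Tendsto (fun j : ℕ => h0 / 2 ^ j) Filter.atTop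
        (nhdsWithin 0 (Set.Ioi 0)) := by
      rw [tendsto_nhdsWithin_iff]
      constructor
      · have := (tendsto_pow_atTop_nhds_zero_of_lt_one (r := (1 / 2 : ℝ)) (by norm_num)
          (by norm_num)).const_mul h0
        simpa [div_eq_mul_inv] using this
      · exact Filter.Eventually.of_forall fun j => by
          simp only [Set.mem_Ioi]; positivity
    obtain ⟨j, hj⟩ := (ht.eventually (numCells_small hn ho hb hne (2 ^ n * l + 1))).exists
    exact ⟨j, hj⟩
  have hfind := Nat.find_spec hex
  have hmin := fun j => @Nat.find_min _ _ hex j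
  generalize Nat.find hex = j at hfind hmin
  rcases j with _ | j
  · exfalso
    simp only [pow_zero, div_one] at hfind
    have : 2 ^ n ≤ 2 ^ n * l := Nat.le_mul_of_pos_right _ hl
    omega
  · refine ⟨h0 / 2 ^ (j + 1), by positivity, hfind, ?_⟩
    have h1 := hmin j (by omega)
    push Not at h1
    have h2 := numCells_refine hb (h0 / 2 ^ j) (by positivity) 2 (by norm_num)
    have e : h0 / 2 ^ j / (2 : ℕ) = h0 / 2 ^ (j + 1) := by
      rw [pow_succ]; field_simp; norm_num
    rw [e] at h2
    calc _ ≤ 2 ^ n * numCells Ω (h0 / 2 ^ j) := h2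
      _ ≤ 2 ^ n * (2 ^ n * l) := by gcongr
      _ = 4 ^ n * l := by rw [← mul_assoc, ← mul_pow]; norm_num

lemma exists_test {n : ℕ} (hn : 1 ≤ n) {Ω : Set (Eu n)} (ho : IsOpen Ω) (hcx : Convex ℝ Ω)
    (hb : Bornology.IsBounded Ω) (hne : Ω.Nonempty) (k : ℕ) (hk : 1 ≤ k) :
    ∃ V, IsTest n k Ω V := by
  obtain ⟨C, hC, hCb⟩ := smoothTransition_deriv_bound
  obtain ⟨h, hh, hN, -⟩ := exists_scale hn hk ho hb hne
  obtain ⟨p, hp, hsep⟩ := packing hb h hh hN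
  exact (upper_bound hn C hC hCb ho hcx hb p hp h hh hsep).1

end NeumannAux

/-- There exists a universal numeric constant `c > 0` such that for every `n ≥ 2`,
every bounded convex domain `Ω ⊆ ℝⁿ`, and all integers `k ≥ l ≥ 1`, the Neumann
eigenvalues satisfy `μ_k(Ω) ≥ (1/(c·n^10)) · (k/l)^(2/n) · μ_l(Ω)`. -/
theorem main_lower_bound :
    ∃ c : ℝ, 0 < c ∧ ∀ n : ℕ, 2 ≤ n →
      ∀ Ω : Set (EuclideanSpace ℝ (Fin n)),
        IsOpen Ω → Convex ℝ Ω → Bornology.IsBounded Ω → Ω.Nonempty →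
        ∀ k l : ℕ, 1 ≤ l → l ≤ k →
          1 / (c * (n : ℝ) ^ 10) * ((k : ℝ) / (l : ℝ)) ^ ((2 : ℝ) / (n : ℝ)) *
              neumannEigenvalue n l Ω ≤
            neumannEigenvalue n k Ω := by
  obtain ⟨C, hC, hCb⟩ := NeumannAux.smoothTransition_deriv_bound
  refine ⟨2 ^ 20 * C ^ 2 + 1024, by positivity, ?_⟩
  intro n hn2 Ω ho hcx hb hne k l hl hlk
  have hn : 1 ≤ n := by omega
  have hn' : (1 : ℝ) ≤ n := by exact_mod_cast hn
  have hl' : (1 : ℝ) ≤ l := by exact_mod_cast hl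
  have hk' : (l : ℝ) ≤ k := by exact_mod_cast hlk
  have htest := NeumannAux.exists_test hn ho hcx hb hne k (hl.trans hlk)
  have hmono := NeumannAux.eigenvalue_mono hlk hb ho htest
  have hnn := NeumannAux.eigenvalue_nonneg n l Ω
  set A := neumannEigenvalue n l Ω with hA
  set B := neumannEigenvalue n k Ω with hB
  set c := 2 ^ 20 * C ^ 2 + 1024 with hc
  have hc0 : 0 < c := by positivity
  set q : ℝ := ((k : ℝ) / l) ^ ((1 : ℝ) / n) with hq
  have hkl : 1 ≤ (k : ℝ) / l := by rw [one_le_div (by linarith)]; exact hk'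
  have hq0 : 0 < q := by positivity
  have hqn : q ^ n = (k : ℝ) / l := by
    rw [hq, ← Real.rpow_natCast, ← Real.rpow_mul (by positivity), one_div,
      inv_mul_cancel₀ (by positivity), Real.rpow_one]
  have hq2 : ((k : ℝ) / l) ^ ((2 : ℝ) / n) = q ^ 2 := by
    rw [hq, ← Real.rpow_natCast, ← Real.rpow_mul (by positivity)]
    congr 1
    push_cast; ring
  rw [hq2]
  suffices hs : q ^ 2 * A ≤ c * n ^ 10 * B by
    calc 1 / (c * (n : ℝ) ^ 10) * q ^ 2 * A = (q ^ 2 * A) / (c * (n : ℝ) ^ 10) := by ring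
      _ ≤ B := by rw [div_le_iff₀ (by positivity)]; linarith
  have hB0 : 0 ≤ B := hnn.trans hmono
  by_cases hm : q < 32 * n
  · calc q ^ 2 * A ≤ (32 * n) ^ 2 * B := by gcongr
      _ = 1024 * n ^ 2 * B := by ring
      _ ≤ c * n ^ 10 * B := by
        gcongr
        · rw [hc]; nlinarith [sq_nonneg C]
        · norm_num
  · push Not at hm
    obtain ⟨h, hh, hN1, hN2⟩ := NeumannAux.exists_scale hn hl ho hb hne
    obtain ⟨p, hp, hsep⟩ := NeumannAux.packing hb h hh hN1
    have hup := (NeumannAux.upper_bound hn C hC hCb ho hcx hb p hp h hh hsep).2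
    rw [← hA] at hup
    set m := ⌊q / (32 * n)⌋₊ with hmdef
    have hx1 : 1 ≤ q / (32 * n) := by rw [one_le_div (by positivity)]; exact hm
    have hm1 : 1 ≤ m := Nat.one_le_floor_iff _ |>.2 hx1
    have hm1' : (1 : ℝ) ≤ m := by exact_mod_cast hm1
    have hmle : (m : ℝ) ≤ q / (32 * n) := Nat.floor_le (by positivity)
    have hmlt : q / (32 * n) < m + 1 := Nat.lt_floor_add_one _
    have hmq : q ≤ 64 * n * m := by
      rw [div_lt_iff₀ (by positivity)] at hmlt
      nlinarith
    have hmk : (32 * n * m) ^ n * l ≤ k := by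
      have h1 : (32 * n * m : ℝ) ≤ q := by
        rw [le_div_iff₀ (by positivity)] at hmle; linarith
      have h2 : (32 * n * m : ℝ) ^ n ≤ k / l := by rw [← hqn]; gcongr
      rw [le_div_iff₀ (by linarith)] at h2
      exact_mod_cast h2
    have hcells := NeumannAux.numCells_refine hb h hh m hm1
    have hcard : 4 * (NeumannAux.numCells Ω (h / m) * (2 * n) ^ n) ≤ k + 1 := by
      calc 4 * (NeumannAux.numCells Ω (h / m) * (2 * n) ^ n)
          ≤ 4 * ((m ^ n * (4 ^ n * l)) * (2 * n) ^ n) := by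
            gcongr; exact hcells.trans (by gcongr)
        _ ≤ 4 ^ n * ((m ^ n * (4 ^ n * l)) * (2 * n) ^ n) := by
            gcongr; exact Nat.le_self_pow (by omega) 4
        _ = (32 * n * m) ^ n * l := by
            have e : (32 * n * m) ^ n = 4 ^ n * m ^ n * 4 ^ n * (2 * n) ^ n := by
              rw [← mul_pow, ← mul_pow, ← mul_pow]; congr 1; ring
            rw [e]; ring
        _ ≤ k + 1 := by omega
    have hlow := NeumannAux.lower_bound hn ho hcx hb htest (h / m) (by positivity) hcard
    rw [← hB] at hlow
    calc q ^ 2 * A ≤ (64 * n * m) ^ 2 * (2 * (8 * C * n / h) ^ 2) := by gcongr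
      _ = 2 ^ 20 * C ^ 2 * n ^ 3 * (n / (2 * (h / m) ^ 2)) := by field_simp; ring
      _ ≤ c * n ^ 10 * B := by
        have h310 : (n : ℝ) ^ 3 ≤ n ^ 10 := pow_le_pow_right₀ hn' (by norm_num)
        gcongr
        rw [hc]; linarith
end

section
/- There exists a universal numeric constant c > 0 such that for every n ≥ 2, every bounded convex domain Ω in ℝⁿ, and all integers k ≥ l ≥ 1, the Neumann eigenvalues of the Laplacian satisfy μ_k(Ω) ≤ c·n^10 · (k/l)² · μ_l(Ω). -/
open MeasureTheory

open scoped ENNReal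

lemma bm1 (A B C : Set ℝ) (hA : MeasurableSet A) (hB : MeasurableSet B)
    (hA0 : A.Nonempty) (hB0 : B.Nonempty)
    (h : ∀ a ∈ A, ∀ b ∈ B, (a + b) / 2 ∈ C) : volume A + volume B ≤ 2 * volume C := by
  obtain ⟨a0, ha0⟩ := hA0
  obtain ⟨b0, hb0⟩ := hB0
  have key : ∀ K L : Set ℝ, IsCompact K → IsCompact L → K ⊆ A → L ⊆ B → K.Nonempty → L.Nonempty →
      volume K + volume L ≤ 2 * volume C := by
    intro K L hK hL hKA hLB hK0 hL0
    obtain ⟨a, haK, ha⟩ := hK.exists_isGreatest hK0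
    obtain ⟨b, hbL, hb⟩ := hL.exists_isLeast hL0
    have hD : volume ((fun x : ℝ => x * (1/2)) ⁻¹' C) = 2 * volume C := by
      rw [Real.volume_preimage_mul_right (by norm_num)]
      norm_num
    rw [← hD]
    have h1 : volume ((fun x => x + (-b)) ⁻¹' K) = volume K := measure_preimage_add_right _ _ _
    have h2 : volume ((fun x => x + (-a)) ⁻¹' L) = volume L := measure_preimage_add_right _ _ _
    have hm1 : MeasurableSet ((fun x => x + (-b)) ⁻¹' K) := (measurable_add_const _) hK.measurableSet
    have hm2 : MeasurableSet ((fun x => x + (-a)) ⁻¹' L) := (measurable_add_const _) hL.measurableSet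
    rw [← h1, ← h2]
    have hdis : AEDisjoint volume ((fun x => x + (-b)) ⁻¹' K) ((fun x => x + (-a)) ⁻¹' L) := by
      refine measure_mono_null (t := {a + b}) ?_ (by simp)
      rintro x ⟨hx1, hx2⟩
      have := ha hx1
      have := hb hx2
      simp only [Set.mem_singleton_iff]
      linarith
    rw [← measure_union₀ hm2.nullMeasurableSet hdis]
    apply measure_mono
    rintro x (hx | hx)
    · have := h _ (hKA hx) _ (hLB hbL)
      simp only [Set.mem_preimage]
      convert this using 1; ring
    · have := h _ (hKA haK) _ (hLB hx)
      simp only [Set.mem_preimage]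
      convert this using 1; ring
  rw [hA.measure_eq_iSup_isCompact, hB.measure_eq_iSup_isCompact]
  have : Nonempty {K : Set ℝ // K ⊆ A ∧ IsCompact K} := ⟨∅, by simp, isCompact_empty⟩
  have : Nonempty {K : Set ℝ // K ⊆ B ∧ IsCompact K} := ⟨∅, by simp, isCompact_empty⟩
  have : ∀ K L : Set ℝ, K ⊆ A → IsCompact K → L ⊆ B → IsCompact L →
      volume K + volume L ≤ 2 * volume C := by
    intro K L hKA hK hLB hL
    refine le_trans ?_ (key (insert a0 K) (insert b0 L) (hK.insert _) (hL.insert _)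
      (Set.insert_subset ha0 hKA) (Set.insert_subset hb0 hLB) (by simp) (by simp))
    gcongr <;> exact Set.subset_insert _ _
  simp only [iSup_and']
  simp only [iSup_subtype']
  refine ENNReal.iSup_add_iSup_le ?_
  rintro ⟨K, hK⟩ ⟨L, hL⟩
  exact this K L hK.1 hK.2 hL.1 hL.2

lemma layer (f : ℝ → ℝ≥0∞) (hf : Measurable f) (h1 : ∀ x, f x ≤ 1) :
    ∫⁻ x, f x = ∫⁻ t in Set.Ioi (0:ℝ), volume {x | ENNReal.ofReal t < f x} := by
  have e : ∀ x, f x = ENNReal.ofReal (f x).toReal := fun x =>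
    (ENNReal.ofReal_toReal ((h1 x).trans_lt ENNReal.one_lt_top).ne).symm
  rw [lintegral_congr e, lintegral_eq_lintegral_meas_lt _ (Filter.Eventually.of_forall (by simp))
    hf.ennreal_toReal.aemeasurable]
  refine setLIntegral_congr_fun measurableSet_Ioi ?_
  intro t ht
  show volume _ = volume _
  congr 1
  ext x
  simp only [Set.mem_ofPred_eq]
  rw [ENNReal.ofReal_lt_iff_lt_toReal (le_of_lt ht) ((h1 x).trans_lt ENNReal.one_lt_top).ne]

lemma pl_norm (f g h : ℝ → ℝ≥0∞) (hf : Measurable f) (hg : Measurable g) (hh : Measurable h)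
    (hfs : ⨆ x, f x = 1) (hgs : ⨆ x, g x = 1)
    (H : ∀ x y, f x * g y ≤ h ((x + y) / 2) ^ 2) :
    (∫⁻ x, f x) + ∫⁻ x, g x ≤ 2 * ∫⁻ x, h x := by
  have hf1 : ∀ x, f x ≤ 1 := fun x => hfs ▸ le_iSup f x
  have hg1 : ∀ x, g x ≤ 1 := fun x => hgs ▸ le_iSup g x
  refine le_trans ?_ (mul_le_mul_right (lintegral_mono (fun x => min_le_left (h x) 1)) 2)
  rw [layer f hf hf1, layer g hg hg1, layer _ (hh.min measurable_const) (fun x => min_le_right _ _)]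
  have ml : ∀ u : ℝ → ℝ≥0∞, Measurable fun t : ℝ => volume {x | ENNReal.ofReal t < u x} := by
    intro u
    apply Antitone.measurable
    intro s t hst
    apply measure_mono
    intro x hx
    exact lt_of_le_of_lt (ENNReal.ofReal_le_ofReal hst) hx
  rw [← lintegral_add_left (ml f), ← lintegral_const_mul _ (ml _)]
  refine setLIntegral_mono_ae' measurableSet_Ioi (Filter.Eventually.of_forall ?_)
  intro t ht
  by_cases ht1 : t < 1
  · have hlt : ENNReal.ofReal t < 1 := by simpa using ht1
    apply bm1
    · exact measurableSet_lt measurable_const hf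
    · exact measurableSet_lt measurable_const hg
    · exact lt_iSup_iff.1 (hfs ▸ hlt)
    · exact lt_iSup_iff.1 (hgs ▸ hlt)
    · intro a ha b hb
      refine lt_min ?_ hlt
      by_contra hcon
      have hcon := not_lt.1 hcon
      have h1 := H a b
      have h2 : ENNReal.ofReal t * ENNReal.ofReal t < f a * g b := ENNReal.mul_lt_mul ha hb
      have h3 : h ((a+b)/2) ^ 2 ≤ ENNReal.ofReal t * ENNReal.ofReal t := by
        rw [sq]; gcongr
      exact absurd (h2.trans_le (h1.trans h3)) (lt_irrefl _)
  · have hle : 1 ≤ ENNReal.ofReal t := by simpa using not_lt.1 ht1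
    have e1 : {x | ENNReal.ofReal t < f x} = ∅ := by
      ext x; simpa using (hf1 x).trans hle
    have e2 : {x | ENNReal.ofReal t < g x} = ∅ := by
      ext x; simpa using (hg1 x).trans hle
    rw [e1, e2]; simp

lemma amgm (x y : ℝ≥0∞) : 4 * (x * y) ≤ (x + y) ^ 2 := by
  by_cases hx : x = ⊤
  · subst hx; simp
  by_cases hy : y = ⊤
  · subst hy; simp
  lift x to NNReal using hx
  lift y to NNReal using hy
  norm_cast
  rw [← NNReal.coe_le_coe]
  push_cast
  nlinarith [sq_nonneg ((x:ℝ) - y)]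

lemma pl_bdd (f g h : ℝ → ℝ≥0∞) (hf : Measurable f) (hg : Measurable g) (hh : Measurable h)
    (hfs : ⨆ x, f x ≠ ⊤) (hgs : ⨆ x, g x ≠ ⊤)
    (H : ∀ x y, f x * g y ≤ h ((x + y) / 2) ^ 2) :
    (∫⁻ x, f x) * ∫⁻ x, g x ≤ (∫⁻ x, h x) ^ 2 := by
  set a := ⨆ x, f x with ha
  set b := ⨆ x, g x with hb
  by_cases ha0 : a = 0
  · have : ∀ x, f x = 0 := fun x => le_antisymm (ha0 ▸ le_iSup f x) bot_le
    simp [this]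
  by_cases hb0 : b = 0
  · have : ∀ x, g x = 0 := fun x => le_antisymm (hb0 ▸ le_iSup g x) bot_le
    simp [this]
  obtain ⟨c, hc⟩ : ∃ c : ℝ≥0∞, c ^ 2 = a⁻¹ * b⁻¹ := by
    refine ⟨(a⁻¹ * b⁻¹) ^ (1/2 : ℝ), ?_⟩
    rw [← ENNReal.rpow_natCast, ← ENNReal.rpow_mul]; norm_num
  have hc0 : c ^ 2 ≠ 0 := by rw [hc]; simp [hfs, hgs]
  have hct : c ^ 2 ≠ ⊤ := by
    rw [hc]; exact ENNReal.mul_ne_top (by simpa using ha0) (by simpa using hb0)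
  have key := pl_norm (fun x => a⁻¹ * f x) (fun x => b⁻¹ * g x) (fun x => c * h x)
    (hf.const_mul _) (hg.const_mul _) (hh.const_mul _)
    (by rw [← ENNReal.mul_iSup, ← ha, ENNReal.inv_mul_cancel ha0 hfs])
    (by rw [← ENNReal.mul_iSup, ← hb, ENNReal.inv_mul_cancel hb0 hgs])
    (by
      intro x y
      have := H x y
      calc a⁻¹ * f x * (b⁻¹ * g y) = c ^ 2 * (f x * g y) := by rw [hc]; ring
        _ ≤ c ^ 2 * h ((x + y) / 2) ^ 2 := by gcongr
        _ = _ := by ring)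
  rw [lintegral_const_mul _ hf, lintegral_const_mul _ hg, lintegral_const_mul _ hh] at key
  have h2 := (amgm (a⁻¹ * ∫⁻ x, f x) (b⁻¹ * ∫⁻ x, g x)).trans (pow_le_pow_left' key 2)
  have h3 : 4 * c ^ 2 * ((∫⁻ x, f x) * ∫⁻ x, g x) ≤ 4 * c ^ 2 * (∫⁻ x, h x) ^ 2 := by
    calc _ = 4 * (a⁻¹ * (∫⁻ x, f x) * (b⁻¹ * ∫⁻ x, g x)) := by rw [hc]; ring
      _ ≤ _ := h2
      _ = _ := by ring
  exact (ENNReal.mul_le_mul_iff_right (by simp [hc0]) (ENNReal.mul_ne_top (by simp) hct)).1 h3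

lemma lint_trunc {α : Type*} [MeasurableSpace α] (μ : Measure α) (f : α → ℝ≥0∞)
    (hf : Measurable f) :
    ∫⁻ x, f x ∂μ = ⨆ N : ℕ, ∫⁻ x, min (f x) N ∂μ := by
  rw [← lintegral_iSup (fun N => hf.min measurable_const)]
  · congr 1
    ext x
    rw [← inf_iSup_eq, ENNReal.iSup_natCast]; simp
  · intro i j hij x
    exact min_le_min_left _ (by exact_mod_cast hij)

lemma pl_one (f g h : ℝ → ℝ≥0∞) (hf : Measurable f) (hg : Measurable g) (hh : Measurable h)
    (H : ∀ x y, f x * g y ≤ h ((x + y) / 2) ^ 2) :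
    (∫⁻ x, f x) * ∫⁻ x, g x ≤ (∫⁻ x, h x) ^ 2 := by
  rw [lint_trunc _ f hf, lint_trunc _ g hg, ENNReal.iSup_mul]
  refine iSup_le fun N => ?_
  rw [ENNReal.mul_iSup]
  refine iSup_le fun M => ?_
  apply pl_bdd _ _ _ (hf.min measurable_const) (hg.min measurable_const) hh
  · exact ((iSup_le fun x => min_le_right _ _).trans_lt (ENNReal.natCast_lt_top N)).ne
  · exact ((iSup_le fun x => min_le_right _ _).trans_lt (ENNReal.natCast_lt_top M)).ne
  · intro x y
    exact (mul_le_mul' (min_le_left _ _) (min_le_left _ _)).trans (H x y)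

lemma pl_pi (n : ℕ) : ∀ (f g h : (Fin n → ℝ) → ℝ≥0∞), Measurable f → Measurable g →
    Measurable h →
    (∀ x y, f x * g y ≤ h ((2:ℝ)⁻¹ • (x + y)) ^ 2) →
    (∫⁻ x, f x) * ∫⁻ x, g x ≤ (∫⁻ x, h x) ^ 2 := by
  induction n with
  | zero =>
    intro f g h hf hg hh H
    have e : ∀ u : (Fin 0 → ℝ) → ℝ≥0∞, ∫⁻ x, u x = u 0 := by
      intro u
      rw [lintegral_unique]
      simp [volume_pi]
      exact congrArg u (Subsingleton.elim _ _)
    rw [e, e, e]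
    convert H 0 0 using 3
  | succ n ih =>
    intro f g h hf hg hh H
    have mp := (volume_preserving_piFinSuccAbove (fun _ : Fin (n+1) => ℝ) 0).symm
    have hcons : ∀ (s : ℝ) (z : Fin n → ℝ),
        (MeasurableEquiv.piFinSuccAbove (fun _ : Fin (n+1) => ℝ) 0).symm (s, z)
          = (Fin.cons s z : Fin (n+1) → ℝ) := by
      intro s z
      simp [MeasurableEquiv.piFinSuccAbove, Fin.insertNthEquiv]
    have e : ∀ u : (Fin (n+1) → ℝ) → ℝ≥0∞, Measurable u →
        ∫⁻ x, u x = ∫⁻ s : ℝ, ∫⁻ z : Fin n → ℝ, u (Fin.cons s z) := by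
      intro u hu
      rw [← mp.lintegral_comp hu, Measure.volume_eq_prod, lintegral_prod _ (by
        exact (hu.comp mp.measurable).aemeasurable)]
      simp only [hcons]
    have mc : Measurable fun p : ℝ × (Fin n → ℝ) => (Fin.cons p.1 p.2 : Fin (n+1) → ℝ) :=
      by
        have := mp.measurable
        convert this using 1
        ext1 p
        exact (hcons p.1 p.2).symm
    rw [e f hf, e g hg, e h hh]
    refine pl_one _ _ _ (hf.comp mc).lintegral_prod_right' (hg.comp mc).lintegral_prod_right'
      (hh.comp mc).lintegral_prod_right' ?_
    intro s t
    refine ih _ _ _ ((hf.comp mc).comp measurable_prodMk_left)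
      ((hg.comp mc).comp measurable_prodMk_left) ((hh.comp mc).comp measurable_prodMk_left) ?_
    intro x y
    convert H (Fin.cons s x) (Fin.cons t y) using 3
    ext i
    refine Fin.cases ?_ (fun j => ?_) i
    · simp; ring
    · simp; ring

lemma pl_euc (n : ℕ) (f g h : EuclideanSpace ℝ (Fin n) → ℝ≥0∞) (hf : Measurable f)
    (hg : Measurable g) (hh : Measurable h)
    (H : ∀ x y, f x * g y ≤ h ((2:ℝ)⁻¹ • (x + y)) ^ 2) :
    (∫⁻ x, f x) * ∫⁻ x, g x ≤ (∫⁻ x, h x) ^ 2 := by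
  have mp := PiLp.volume_preserving_toLp (Fin n)
  rw [← mp.lintegral_comp hf, ← mp.lintegral_comp hg, ← mp.lintegral_comp hh]
  refine pl_pi n _ _ _ (hf.comp mp.measurable) (hg.comp mp.measurable) (hh.comp mp.measurable) ?_
  intro x y
  exact H _ _

lemma exp_lower {M e a b : ℝ} (hM : 1 ≤ M) (ha : |a| ≤ M) (hb : |b| ≤ M) (he : 0 < e)
    (he1 : 2 * M * e ≤ 1) :
    1 + e * a - e ^ 2 * b + e ^ 2 * a ^ 2 / 2 - 3 * M ^ 3 * e ^ 3 ≤ Real.exp (e * a - e ^ 2 * b) := by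
  set s := e * a - e ^ 2 * b with hs
  have heM : e ≤ 1 := by nlinarith
  have hs1 : |s| ≤ 2 * M * e := by
    calc |s| ≤ |e * a| + |e ^ 2 * b| := abs_sub _ _
      _ = e * |a| + e ^ 2 * |b| := by rw [abs_mul, abs_mul, abs_of_pos he, abs_of_pos (pow_pos he 2)]
      _ ≤ e * M + e * M := by
        gcongr
        nlinarith
      _ = _ := by ring
  have h := Real.exp_bound (hs1.trans he1) (n := 3) (by norm_num)
  have h3 : |s| ^ 3 ≤ (2 * M * e) ^ 3 := by gcongr
  simp [Finset.sum_range_succ, Nat.factorial] at h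
  have h4 := (abs_le.1 h).1
  have h5 : s ^ 2 ≥ e ^ 2 * a ^ 2 - 2 * e ^ 3 * M ^ 2 := by
    have : a * b ≤ M ^ 2 := by
      calc a * b ≤ |a * b| := le_abs_self _
        _ = |a| * |b| := abs_mul _ _
        _ ≤ M * M := by gcongr
        _ = _ := by ring
    have h6 : s ^ 2 = e ^ 2 * a ^ 2 - 2 * e ^ 3 * (a * b) + (e ^ 2 * b) ^ 2 := by rw [hs]; ring
    have : e ^ 3 * (a * b) ≤ e ^ 3 * M ^ 2 := by gcongr
    nlinarith [sq_nonneg (e ^ 2 * b)]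
  have h7 : e ^ 3 * M ^ 2 ≤ e ^ 3 * M ^ 3 := by
    gcongr
    · norm_num
  have h8 : 0 ≤ e ^ 3 * M ^ 3 := by positivity
  have h9 : (2 * M * e) ^ 3 = 8 * (e ^ 3 * M ^ 3) := by ring
  rw [h9] at h3
  linarith

lemma taylor_bd {E : Type*} [NormedAddCommGroup E] [NormedSpace ℝ E] [FiniteDimensional ℝ E]
    (φ : E → ℝ) (hφ : ContDiff ℝ (⊤ : ℕ∞) φ) (A : Set E) (hA : Bornology.IsBounded A) :
    ∃ L : ℝ, 0 ≤ L ∧ ∀ x ∈ A, ∀ y ∈ A, φ x - φ y ≤ ‖fderiv ℝ φ x‖ * ‖x - y‖ + L * ‖x - y‖ ^ 2 := by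
  obtain ⟨r, hr⟩ := hA.subset_closedBall 0
  set B := Metric.closedBall (0:E) r
  have hBc : IsCompact B := isCompact_closedBall _ _
  have hBv : Convex ℝ B := convex_closedBall _ _
  have h1 : ContDiff ℝ 1 (fderiv ℝ φ) := hφ.fderiv_right (by norm_cast)
  obtain ⟨L, hL⟩ := hBc.exists_bound_of_continuousOn (f := fderiv ℝ (fderiv ℝ φ))
    (h1.continuous_fderiv (by norm_num)).continuousOn
  refine ⟨max L 0, le_max_right _ _, ?_⟩
  intro x hx y hy
  have hxB := hr hx
  have hyB := hr hy
  have hlip : ∀ z ∈ B, ‖fderiv ℝ φ z - fderiv ℝ φ x‖ ≤ max L 0 * ‖z - x‖ := by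
    intro z hz
    exact hBv.norm_image_sub_le_of_norm_fderiv_le (fun w _ => (h1.differentiable (by norm_num)) w)
      (fun w hw => (hL w hw).trans (le_max_left _ _)) hxB hz
  have hdφ : Differentiable ℝ φ := hφ.differentiable (by norm_num)
  have hseg : Convex ℝ (segment ℝ x y) := convex_segment _ _
  have := hseg.norm_image_sub_le_of_norm_hasFDerivWithin_le' (f := φ) (f' := fderiv ℝ φ)
    (φ := fderiv ℝ φ x) (C := max L 0 * ‖y - x‖)
    (fun w _ => (hdφ w).hasFDerivAt.hasFDerivWithinAt)
    (fun w hw => (hlip w (hBv.segment_subset hxB hyB hw)).trans (by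
      gcongr
      exact (norm_sub_le_of_mem_segment hw)))
    (left_mem_segment ℝ x y) (right_mem_segment ℝ x y)
  have h2 := (abs_le.1 (Real.norm_eq_abs _ ▸ this)).1
  have h3 : fderiv ℝ φ x (y - x) ≥ - (‖fderiv ℝ φ x‖ * ‖y - x‖) :=
    (abs_le.1 ((Real.norm_eq_abs _) ▸ (fderiv ℝ φ x).le_opNorm (y - x))).1
  rw [norm_sub_rev x y]
  nlinarith

lemma contra_eps {Z α β C : ℝ} (hZ : 0 < Z) {e0 : ℝ} (he0 : 0 < e0)
    (h : ∀ e, 0 < e → e ≤ e0 → ∃ a b : ℝ, Z + e ^ 2 * α - C * e ^ 3 ≤ a ∧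
      Z + e ^ 2 * β - C * e ^ 3 ≤ b ∧ a * b ≤ Z ^ 2) : α + β ≤ 0 := by
  by_contra hcon
  have hcon := not_le.1 hcon
  have c1 : Filter.Tendsto (fun e : ℝ => Z * (α + β - 2 * C * e) + e ^ 2 * (α - C * e) * (β - C * e))
      (nhdsWithin 0 (Set.Ioi 0)) (nhds (Z * (α + β))) := by
    have : Continuous (fun e : ℝ => Z * (α + β - 2 * C * e) + e ^ 2 * (α - C * e) * (β - C * e)) := by
      fun_prop
    have := this.tendsto 0
    simp at this
    exact this.mono_left nhdsWithin_le_nhds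
  have c2 : Filter.Tendsto (fun e : ℝ => Z + e ^ 2 * α - C * e ^ 3)
      (nhdsWithin 0 (Set.Ioi 0)) (nhds Z) := by
    have : Continuous (fun e : ℝ => Z + e ^ 2 * α - C * e ^ 3) := by fun_prop
    have := this.tendsto 0
    simp at this
    exact this.mono_left nhdsWithin_le_nhds
  have c3 : Filter.Tendsto (fun e : ℝ => Z + e ^ 2 * β - C * e ^ 3)
      (nhdsWithin 0 (Set.Ioi 0)) (nhds Z) := by
    have : Continuous (fun e : ℝ => Z + e ^ 2 * β - C * e ^ 3) := by fun_prop
    have := this.tendsto 0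
    simp at this
    exact this.mono_left nhdsWithin_le_nhds
  have e1 := c1.eventually_const_lt (mul_pos hZ hcon)
  have e2 := c2.eventually_const_lt hZ
  have e3 := c3.eventually_const_lt hZ
  obtain ⟨e, ⟨⟨⟨h1, h2⟩, h3⟩, h4⟩⟩ := (((e1.and e2).and e3).and
    (Ioc_mem_nhdsGT he0)).exists
  obtain ⟨a, b, ha, hb, hab⟩ := h e h4.1 h4.2
  have h5 : (Z + e ^ 2 * α - C * e ^ 3) * (Z + e ^ 2 * β - C * e ^ 3) ≤ a * b :=
    mul_le_mul ha hb h3.le (h2.le.trans ha)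
  have h6 : 0 < e ^ 2 * (Z * (α + β - 2 * C * e) + e ^ 2 * (α - C * e) * (β - C * e)) :=
    mul_pos (pow_pos h4.1 2) h1
  nlinarith

lemma intOn {n : ℕ} {A : Set (EuclideanSpace ℝ (Fin n))} (hA : Bornology.IsBounded A)
    {u : EuclideanSpace ℝ (Fin n) → ℝ} (hu : Continuous u) : IntegrableOn u A := by
  obtain ⟨r, hr⟩ := hA.subset_closedBall 0
  exact (hu.continuousOn.integrableOn_compact (isCompact_closedBall _ _)).mono_set hr

lemma bddOn {n : ℕ} {A : Set (EuclideanSpace ℝ (Fin n))} (hA : Bornology.IsBounded A)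
    {u : EuclideanSpace ℝ (Fin n) → ℝ} (hu : Continuous u) : ∃ M, ∀ x ∈ A, |u x| ≤ M := by
  obtain ⟨r, hr⟩ := hA.subset_closedBall 0
  obtain ⟨M, hM⟩ := (isCompact_closedBall (0 : EuclideanSpace ℝ (Fin n)) r).exists_bound_of_continuousOn
    hu.continuousOn
  exact ⟨M, fun x hx => hM x (hr hx)⟩

lemma toReal_ind {n : ℕ} {A : Set (EuclideanSpace ℝ (Fin n))} (hA : Bornology.IsBounded A)
    (hAm : MeasurableSet A)
    {u : EuclideanSpace ℝ (Fin n) → ℝ} (hu : Continuous u) (h0 : ∀ x, 0 ≤ u x) :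
    ∫⁻ x, A.indicator (fun x => ENNReal.ofReal (u x)) x = ENNReal.ofReal (∫ x in A, u x) := by
  rw [lintegral_indicator hAm, ofReal_integral_eq_lintegral_ofReal (intOn hA hu)
    (Filter.Eventually.of_forall h0)]

lemma poincare_pl {n : ℕ} {A : Set (EuclideanSpace ℝ (Fin n))} (hAb : Bornology.IsBounded A)
    (hAm : MeasurableSet A) (hAc : Convex ℝ A) {u v w : EuclideanSpace ℝ (Fin n) → ℝ}
    (hu : Continuous u) (hv : Continuous v) (hw : Continuous w)
    (hu0 : ∀ x, 0 ≤ u x) (hv0 : ∀ x, 0 ≤ v x) (hw0 : ∀ x, 0 ≤ w x)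
    (H : ∀ x ∈ A, ∀ y ∈ A, u x * v y ≤ w ((2:ℝ)⁻¹ • (x + y)) ^ 2) :
    (∫ x in A, u x) * (∫ x in A, v x) ≤ (∫ x in A, w x) ^ 2 := by
  have ms : ∀ u : EuclideanSpace ℝ (Fin n) → ℝ, Continuous u →
      Measurable (A.indicator (fun x => ENNReal.ofReal (u x))) := fun u hu =>
    (hu.measurable.ennreal_ofReal).indicator hAm
  have key := pl_euc n (A.indicator (fun x => ENNReal.ofReal (u x)))
    (A.indicator (fun x => ENNReal.ofReal (v x))) (A.indicator (fun x => ENNReal.ofReal (w x)))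
    (ms u hu) (ms v hv) (ms w hw) (by
      intro x y
      by_cases hx : x ∈ A
      · by_cases hy : y ∈ A
        · have hm : (2:ℝ)⁻¹ • (x + y) ∈ A := by
            rw [smul_add]
            exact hAc hx hy (by norm_num) (by norm_num) (by norm_num)
          rw [Set.indicator_of_mem hx, Set.indicator_of_mem hy, Set.indicator_of_mem hm,
            ← ENNReal.ofReal_mul (hu0 _), ← ENNReal.ofReal_pow (hw0 _)]
          exact ENNReal.ofReal_le_ofReal (H x hx y hy)
        · simp [hy]
      · simp [hx])
  rw [toReal_ind hAb hAm hu hu0, toReal_ind hAb hAm hv hv0, toReal_ind hAb hAm hw hw0,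
    ← ENNReal.ofReal_mul (integral_nonneg hu0), ← ENNReal.ofReal_pow (integral_nonneg hw0)] at key
  exact (ENNReal.ofReal_le_ofReal_iff (by positivity)).1 key

lemma poincare {n : ℕ} {A : Set (EuclideanSpace ℝ (Fin n))}
    (hAm : MeasurableSet A) (hAc : Convex ℝ A) (p : EuclideanSpace ℝ (Fin n)) {D : ℝ} (hD : 0 < D)
    (hAD : A ⊆ Metric.closedBall p D) (φ : EuclideanSpace ℝ (Fin n) → ℝ)
    (hφ : ContDiff ℝ (⊤ : ℕ∞) φ)
    (h0 : ∫ x in A, φ x * Real.exp (-(‖x - p‖ ^ 2 / (2 * D ^ 2))) = 0) :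
    ∫ x in A, φ x ^ 2 ≤ 4 * D ^ 2 * ∫ x in A, ‖fderiv ℝ φ x‖ ^ 2 := by
  have hAb : Bornology.IsBounded A := Metric.isBounded_closedBall.subset hAD
  set w : EuclideanSpace ℝ (Fin n) → ℝ := fun x => Real.exp (-(‖x - p‖ ^ 2 / (2 * D ^ 2))) with hwd
  have hw : Continuous w := by fun_prop
  have hw0 : ∀ x, 0 < w x := fun x => Real.exp_pos _
  have hφc : Continuous φ := hφ.continuous
  have hg : Continuous fun x => ‖fderiv ℝ φ x‖ := (hφ.continuous_fderiv (by norm_num)).norm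
  by_cases hA0 : volume A = 0
  · rw [Measure.restrict_eq_zero.2 hA0]; simp
  have hZ : 0 < ∫ x in A, w x := by
    rw [setIntegral_pos_iff_support_of_nonneg_ae
      (Filter.Eventually.of_forall fun x => (hw0 x).le) (intOn hAb hw)]
    have : Function.support w = Set.univ := by
      ext x; simp [(hw0 x).ne']
    rw [this, Set.univ_inter]
    exact pos_iff_ne_zero.2 hA0
  have hI2 : ∫ x in A, φ x ^ 2 * w x ≤ 2 * D ^ 2 * ∫ x in A, ‖fderiv ℝ φ x‖ ^ 2 * w x := by
    obtain ⟨M1, hM1⟩ := bddOn hAb hφc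
    obtain ⟨M2, hM2⟩ := bddOn hAb (u := fun x => 2 * D ^ 2 * ‖fderiv ℝ φ x‖ ^ 2) (by fun_prop)
    obtain ⟨L, hL0, hL⟩ := taylor_bd φ hφ A hAb
    set M := max 1 (max M1 M2) with hMd
    have hM : 1 ≤ M := le_max_left _ _
    have hM1' : ∀ x ∈ A, |φ x| ≤ M := fun x hx =>
      (hM1 x hx).trans ((le_max_left _ _).trans (le_max_right _ _))
    have hM2' : ∀ x ∈ A, |2 * D ^ 2 * ‖fderiv ℝ φ x‖ ^ 2| ≤ M := fun x hx =>
      (hM2 x hx).trans ((le_max_right _ _).trans (le_max_right _ _))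
    have hlow : ∀ (a b : EuclideanSpace ℝ (Fin n) → ℝ), Continuous a → Continuous b →
        (∀ x ∈ A, |a x| ≤ M) → (∀ x ∈ A, |b x| ≤ M) → (∫ x in A, a x * w x = 0) →
        ∀ e, 0 < e → 2 * M * e ≤ 1 →
        (∫ x in A, w x) + e ^ 2 * ((∫ x in A, a x ^ 2 * w x) / 2 - ∫ x in A, b x * w x)
          - (3 * M ^ 3 * ∫ x in A, w x) * e ^ 3 ≤
        ∫ x in A, Real.exp (e * a x - e ^ 2 * b x) * w x := by
      intro a b ha hb haM hbM hab e he he1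
      have h1 : ∫ x in A, (1 + e * a x - e ^ 2 * b x + e ^ 2 * a x ^ 2 / 2 - 3 * M ^ 3 * e ^ 3) * w x
          ≤ ∫ x in A, Real.exp (e * a x - e ^ 2 * b x) * w x := by
        refine setIntegral_mono_on (intOn hAb (by fun_prop)) (intOn hAb (by fun_prop)) hAm ?_
        intro x hx
        exact mul_le_mul_of_nonneg_right (exp_lower hM (haM x hx) (hbM x hx) he he1) (hw0 x).le
      refine le_trans (le_of_eq ?_) h1
      have i1 : IntegrableOn (fun x => (1 - 3 * M ^ 3 * e ^ 3) * w x) A := intOn hAb (by fun_prop)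
      have i2 : IntegrableOn (fun x => e * (a x * w x)) A := intOn hAb (by fun_prop)
      have i3 : IntegrableOn (fun x => e ^ 2 * (b x * w x)) A := intOn hAb (by fun_prop)
      have i4 : IntegrableOn (fun x => (e ^ 2 / 2) * (a x ^ 2 * w x)) A := intOn hAb (by fun_prop)
      have e1 : ∀ x, (1 + e * a x - e ^ 2 * b x + e ^ 2 * a x ^ 2 / 2 - 3 * M ^ 3 * e ^ 3) * w x
        = (((1 - 3 * M ^ 3 * e ^ 3) * w x + e * (a x * w x)) - e ^ 2 * (b x * w x))
          + (e ^ 2 / 2) * (a x ^ 2 * w x) := fun x => by ring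
      simp only [e1]
      have i12 : IntegrableOn (fun x => (1 - 3 * M ^ 3 * e ^ 3) * w x + e * (a x * w x)) A := i1.add i2
      have i123 : IntegrableOn (fun x => (1 - 3 * M ^ 3 * e ^ 3) * w x + e * (a x * w x)
        - e ^ 2 * (b x * w x)) A := i12.sub i3
      rw [integral_add i123 i4, integral_sub i12 i3, integral_add i1 i2]
      simp only [integral_const_mul]
      rw [hab]
      ring
    have := contra_eps (Z := ∫ x in A, w x)
      (α := (∫ x in A, φ x ^ 2 * w x) / 2 - ∫ x in A, (2 * D ^ 2 * ‖fderiv ℝ φ x‖ ^ 2) * w x)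
      (β := (∫ x in A, (- φ x) ^ 2 * w x) / 2 - ∫ x in A, (0:ℝ) * w x)
      (C := 3 * M ^ 3 * ∫ x in A, w x) hZ (e0 := min (1 / (2 * M)) (1 / (8 * D ^ 2 * (L + 1))))
      (by positivity) (by
        intro e he hee
        have he1 : 2 * M * e ≤ 1 := by
          have := hee.trans (min_le_left _ _)
          rw [le_div_iff₀ (by positivity)] at this
          linarith
        have he2 : e * (8 * D ^ 2 * (L + 1)) ≤ 1 := by
          have := hee.trans (min_le_right _ _)
          rwa [le_div_iff₀ (by positivity)] at this
        refine ⟨_, _, hlow φ (fun x => 2 * D ^ 2 * ‖fderiv ℝ φ x‖ ^ 2) hφc (by fun_prop) hM1' hM2'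
          h0 e he he1, hlow (fun x => - φ x) (fun x => 0) (by fun_prop) (by fun_prop)
          (fun x hx => by simpa using hM1' x hx) (fun x hx => by simp; linarith)
          (by simp only [neg_mul, integral_neg, neg_eq_zero]; exact h0) e he he1, ?_⟩
        refine poincare_pl hAb hAm hAc (by fun_prop) (by fun_prop) hw
          (fun x => by positivity [hw0 x]) (fun x => by positivity [hw0 x]) (fun x => (hw0 x).le) ?_
        intro x hx y hy
        simp only [hwd]
        rw [← Real.exp_add, ← Real.exp_add, ← Real.exp_add, ← Real.exp_nat_mul]
        apply Real.exp_le_exp.2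
        have par := parallelogram_law_with_norm ℝ (x - p) (y - p)
        have m1 : (x - p) + (y - p) = (2:ℝ) • ((2:ℝ)⁻¹ • (x + y) - p) := by
          rw [smul_sub, smul_smul]; norm_num; rw [two_smul]; abel
        have m2 : (x - p) - (y - p) = x - y := by abel
        rw [m1, m2, norm_smul, Real.norm_ofNat] at par
        set d := ‖x - y‖
        set g := ‖fderiv ℝ φ x‖
        set m := ‖(2:ℝ)⁻¹ • (x + y) - p‖
        have ht := hL x hx y hy
        have hd : 0 ≤ d := norm_nonneg _
        have q1 : e * (φ x - φ y) ≤ e * (g * d + L * d ^ 2) := by gcongr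
        have q2 : e * L * d ^ 2 ≤ d ^ 2 / (8 * D ^ 2) := by
          rw [le_div_iff₀ (by positivity)]
          nlinarith [sq_nonneg d, mul_pos he (pow_pos hD 2)]
        have q3 : e * g * d ≤ 2 * D ^ 2 * e ^ 2 * g ^ 2 + d ^ 2 / (8 * D ^ 2) := by
          have : 2 * D ^ 2 * e ^ 2 * g ^ 2 + d ^ 2 / (8 * D ^ 2) - e * g * d
            = (4 * D ^ 2 * e * g - d) ^ 2 / (8 * D ^ 2) := by
            field_simp; ring
          have h' : 0 ≤ (4 * D ^ 2 * e * g - d) ^ 2 / (8 * D ^ 2) := by positivity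
          linarith
        have q4 : ‖x - p‖ ^ 2 / (2 * D ^ 2) + ‖y - p‖ ^ 2 / (2 * D ^ 2)
            = 2 * (m ^ 2 / (2 * D ^ 2)) + d ^ 2 / (4 * D ^ 2) := by
          field_simp
          nlinarith
        have q5 : d ^ 2 / (8 * D ^ 2) + d ^ 2 / (8 * D ^ 2) = d ^ 2 / (4 * D ^ 2) := by
          field_simp; ring
        push_cast
        nlinarith)
    simp only [neg_sq, zero_mul, integral_zero, mul_assoc, integral_const_mul] at this
    simp only [mul_assoc]
    linarith
  have hw1 : ∀ x, w x ≤ 1 := fun x => Real.exp_le_one_iff.2 (by simp; positivity)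
  have hw2 : ∀ x ∈ A, 1 ≤ 2 * w x := by
    intro x hx
    have h1 : ‖x - p‖ ≤ D := by simpa [dist_eq_norm] using hAD hx
    have h2 : ‖x - p‖ ^ 2 / (2 * D ^ 2) ≤ 1 / 2 := by
      rw [div_le_div_iff₀ (by positivity) (by positivity)]
      nlinarith [norm_nonneg (x - p)]
    have h3 := Real.add_one_le_exp (-(‖x - p‖ ^ 2 / (2 * D ^ 2)))
    simp only [hwd]
    linarith
  have s1 : ∫ x in A, φ x ^ 2 ≤ ∫ x in A, 2 * (φ x ^ 2 * w x) := by
    refine setIntegral_mono_on (intOn hAb (by fun_prop)) (intOn hAb (by fun_prop)) hAm ?_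
    intro x hx
    nlinarith [hw2 x hx, sq_nonneg (φ x)]
  have s2 : ∫ x in A, ‖fderiv ℝ φ x‖ ^ 2 * w x ≤ ∫ x in A, ‖fderiv ℝ φ x‖ ^ 2 := by
    refine setIntegral_mono_on (intOn hAb (by fun_prop)) (intOn hAb (by fun_prop)) hAm ?_
    intro x hx
    nlinarith [hw1 x, sq_nonneg (‖fderiv ℝ φ x‖)]
  rw [integral_const_mul] at s1
  have : 2 * D ^ 2 * ∫ x in A, ‖fderiv ℝ φ x‖ ^ 2 * w x ≤
    2 * D ^ 2 * ∫ x in A, ‖fderiv ℝ φ x‖ ^ 2 := by gcongr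
  linarith

lemma intpos {n : ℕ} {Ω : Set (EuclideanSpace ℝ (Fin n))} (hO : IsOpen Ω)
    (hb : Bornology.IsBounded Ω) {f : EuclideanSpace ℝ (Fin n) → ℝ} (hf : Continuous f)
    (h : ∃ x ∈ Ω, f x ≠ 0) : 0 < ∫ x in Ω, f x ^ 2 := by
  rw [setIntegral_pos_iff_support_of_nonneg_ae
      (Filter.Eventually.of_forall fun x => sq_nonneg (f x)) (intOn hb (by fun_prop))]
  have ho : IsOpen (Function.support (fun x => f x ^ 2) ∩ Ω) :=
    (((hf.pow 2).isOpen_support)).inter hO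
  obtain ⟨x, hx, hfx⟩ := h
  exact ho.measure_pos _ ⟨x, by simpa using hfx, hx⟩

lemma rayleigh_bdd {n l : ℕ} {Ω : Set (EuclideanSpace ℝ (Fin n))} (hO : IsOpen Ω)
    (hb : Bornology.IsBounded Ω) (V : Submodule ℝ (EuclideanSpace ℝ (Fin n) → ℝ))
    (hV : Module.finrank ℝ V = l + 1) (hVs : ∀ f ∈ V, ContDiff ℝ (⊤ : ℕ∞) f)
    (hVi : ∀ f ∈ V, (∀ x ∈ Ω, f x = 0) → f = 0) :
    BddAbove (Set.range fun f : {f : EuclideanSpace ℝ (Fin n) → ℝ // f ∈ V ∧ f ≠ 0} =>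
      (∫ x in Ω, ‖fderiv ℝ f.1 x‖ ^ 2) / ∫ x in Ω, (f.1 x) ^ 2) := by
  have hfd : FiniteDimensional ℝ V := Module.finite_of_finrank_pos (by omega)
  let b := Module.finBasis ℝ V
  set N := Module.finrank ℝ V with hN
  have hbs : ∀ i, ContDiff ℝ (⊤ : ℕ∞) (b i : EuclideanSpace ℝ (Fin n) → ℝ) := fun i => hVs _ (b i).2
  have hbc : ∀ i, Continuous (b i : EuclideanSpace ℝ (Fin n) → ℝ) := fun i => (hbs i).continuous
  have hbdiff : ∀ i, Differentiable ℝ (b i : EuclideanSpace ℝ (Fin n) → ℝ) := fun i =>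
    (hbs i).differentiable (by norm_num)
  have hC : ∀ i, ∃ C, ∀ x ∈ Ω, |‖fderiv ℝ (b i : EuclideanSpace ℝ (Fin n) → ℝ) x‖| ≤ C := fun i =>
    bddOn hb ((hbs i).continuous_fderiv (by norm_num)).norm
  choose C hC using hC
  -- the quadratic form
  let F : (Fin N → ℝ) → EuclideanSpace ℝ (Fin n) → ℝ := fun a x => ∑ i, a i * (b i).1 x
  have hFc : ∀ a, Continuous (F a) := fun a => by
    apply continuous_finsetSum; intro i _; exact (hbc i).const_smul (a i)
  have hFV : ∀ a, F a = (∑ i, a i • b i : V).1 := by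
    intro a
    ext x
    simp [F]
  let q : (Fin N → ℝ) → ℝ := fun a => ∫ x in Ω, F a x ^ 2
  have hq : ∀ a, q a = ∑ i, ∑ j, a i * a j * ∫ x in Ω, (b i).1 x * (b j).1 x := by
    intro a
    have : ∀ x, F a x ^ 2 = ∑ i, ∑ j, a i * a j * ((b i).1 x * (b j).1 x) := by
      intro x
      simp only [F]
      rw [sq, Finset.sum_mul_sum]
      refine Finset.sum_congr rfl fun i _ => Finset.sum_congr rfl fun j _ => by ring
    simp only [q, this]
    have hi : ∀ i j, Integrable (fun x => a i * a j * ((b i).1 x * (b j).1 x)) (volume.restrict Ω) :=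
      fun i j => intOn hb (((hbc i).mul (hbc j)).const_smul (a i * a j))
    rw [integral_finsetSum _ (fun i _ => integrable_finsetSum _ (fun j _ => hi i j))]
    refine Finset.sum_congr rfl fun i _ => ?_
    rw [integral_finsetSum _ (fun j _ => hi i j)]
    refine Finset.sum_congr rfl fun j _ => ?_
    rw [integral_const_mul]
  have hqc : Continuous q := by
    have : q = fun a => ∑ i, ∑ j, a i * a j * ∫ x in Ω, (b i).1 x * (b j).1 x := funext hq
    rw [this]; fun_prop
  have hqpos : ∀ a, a ≠ 0 → 0 < q a := by
    intro a ha
    apply intpos hO hb (hFc a)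
    by_contra hcon
    push Not at hcon
    have h1 := hVi (F a) (by rw [hFV]; exact Subtype.property _) hcon
    rw [hFV] at h1
    have h2 : (∑ i, a i • b i : V) = 0 := Subtype.ext h1
    exact ha (funext (fun i => (Fintype.linearIndependent_iff.1 b.linearIndependent) a h2 i))
  have hqs : ∀ (t : ℝ) a, q (t • a) = t ^ 2 * q a := by
    intro t a
    simp only [q]
    rw [← integral_const_mul]
    congr 1; ext x
    simp only [F, Pi.smul_apply, smul_eq_mul, mul_assoc, ← Finset.mul_sum]
    ring
  have hN0 : 0 < N := by omega
  have hne : Nonempty (Fin N) := ⟨⟨0, hN0⟩⟩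
  obtain ⟨a0, ha0, hmin⟩ := (isCompact_sphere (0 : Fin N → ℝ) 1).exists_isMinOn
    (NormedSpace.sphere_nonempty.2 zero_le_one) hqc.continuousOn
  have ha00 : a0 ≠ 0 := by
    rintro rfl; simp at ha0
  have hm := hqpos a0 ha00
  have hlow : ∀ a, ‖a‖ ^ 2 * q a0 ≤ q a := by
    intro a
    by_cases ha : a = 0
    · subst ha; simp; exact integral_nonneg fun x => sq_nonneg _
    have hna : 0 < ‖a‖ := norm_pos_iff.2 ha
    have h1 : q a0 ≤ q (‖a‖⁻¹ • a) := hmin (by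
      simp [norm_smul, hna.ne'])
    rw [hqs] at h1
    calc ‖a‖ ^ 2 * q a0 ≤ ‖a‖ ^ 2 * (‖a‖⁻¹ ^ 2 * q a) := by gcongr
      _ = q a := by field_simp
  set S := ∑ i, C i with hS
  refine ⟨(S ^ 2 * volume.real Ω) / q a0, ?_⟩
  rintro _ ⟨⟨f, hfV, hf0⟩, rfl⟩
  simp only
  set a : Fin N → ℝ := fun i => b.repr ⟨f, hfV⟩ i with ha
  have hfa : f = F a := by
    rw [hFV, ha, b.sum_repr]
  have haz : a ≠ 0 := by
    rintro h
    apply hf0; rw [hfa, h]; ext x; simp [F]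
  have hupp : ∫ x in Ω, ‖fderiv ℝ f x‖ ^ 2 ≤ ‖a‖ ^ 2 * S ^ 2 * volume.real Ω := by
    have hle : ∀ x ∈ Ω, ‖fderiv ℝ f x‖ ^ 2 ≤ ‖a‖ ^ 2 * S ^ 2 := by
      intro x hx
      have : fderiv ℝ f x = ∑ i, a i • fderiv ℝ (b i).1 x := by
        rw [hfa]
        simp only [F]
        rw [fderiv_fun_sum (fun i _ => ((hbdiff i) x).const_mul (a i))]
        refine Finset.sum_congr rfl fun i _ => ?_
        rw [fderiv_const_mul ((hbdiff i) x)]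
      have h2 : ‖fderiv ℝ f x‖ ≤ ‖a‖ * S := by
        rw [this, hS, Finset.mul_sum]
        refine norm_sum_le_of_le _ fun i _ => ?_
        rw [norm_smul]
        exact mul_le_mul (norm_le_pi_norm a i) ((le_abs_self _).trans (hC i x hx)) (norm_nonneg _)
          (norm_nonneg _)
      calc ‖fderiv ℝ f x‖ ^ 2 ≤ (‖a‖ * S) ^ 2 := by gcongr
        _ = _ := by ring
    have hΩt : volume Ω ≠ ⊤ := hb.measure_lt_top.ne
    have h3 := setIntegral_mono_on (μ := volume) (f := fun x => ‖fderiv ℝ f x‖ ^ 2)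
      (g := fun _ => ‖a‖ ^ 2 * S ^ 2)
      (intOn hb ((((hVs f hfV).continuous_fderiv (by norm_num)).norm.pow 2)))
      (intOn hb continuous_const) hO.measurableSet hle
    rw [setIntegral_const, smul_eq_mul] at h3
    linarith
  have hden : ‖a‖ ^ 2 * q a0 ≤ ∫ x in Ω, f x ^ 2 := by
    have := hlow a
    simp only [q] at this ⊢
    rw [hfa]; exact this
  have hna : 0 < ‖a‖ := norm_pos_iff.2 haz
  rw [div_le_div_iff₀ (lt_of_lt_of_le (by positivity) hden) hm]
  have hSv : 0 ≤ S ^ 2 * volume.real Ω := by positivity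
  calc _ ≤ ‖a‖ ^ 2 * S ^ 2 * volume.real Ω * q a0 := by gcongr
    _ = S ^ 2 * volume.real Ω * (‖a‖ ^ 2 * q a0) := by ring
    _ ≤ _ := by gcongr

lemma half_le {n : ℕ} (a b : EuclideanSpace ℝ (Fin n)) :
    {x : EuclideanSpace ℝ (Fin n) | ‖x - a‖ ≤ ‖x - b‖} =
      {x | inner ℝ (b - a) x ≤ (‖b‖ ^ 2 - ‖a‖ ^ 2) / 2} := by
  ext x
  simp only [Set.mem_ofPred_eq]
  rw [← sq_le_sq₀ (norm_nonneg _) (norm_nonneg _), norm_sub_sq_real, norm_sub_sq_real,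
    inner_sub_left, real_inner_comm x b, real_inner_comm x a]
  constructor <;> intro h <;> linarith

lemma half_lt {n : ℕ} (a b : EuclideanSpace ℝ (Fin n)) :
    {x : EuclideanSpace ℝ (Fin n) | ‖x - a‖ < ‖x - b‖} =
      {x | inner ℝ (b - a) x < (‖b‖ ^ 2 - ‖a‖ ^ 2) / 2} := by
  ext x
  simp only [Set.mem_ofPred_eq]
  rw [← sq_lt_sq₀ (norm_nonneg _) (norm_nonneg _), norm_sub_sq_real, norm_sub_sq_real,
    inner_sub_left, real_inner_comm x b, real_inner_comm x a]
  constructor <;> intro h <;> linarith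

lemma convex_half_le {n : ℕ} (a b : EuclideanSpace ℝ (Fin n)) :
    Convex ℝ {x : EuclideanSpace ℝ (Fin n) | ‖x - a‖ ≤ ‖x - b‖} := by
  rw [half_le]
  exact convex_halfSpace_le (innerₛₗ ℝ (b - a)).isLinear _

lemma convex_half_lt {n : ℕ} (a b : EuclideanSpace ℝ (Fin n)) :
    Convex ℝ {x : EuclideanSpace ℝ (Fin n) | ‖x - a‖ < ‖x - b‖} := by
  rw [half_lt]
  exact convex_halfSpace_lt (innerₛₗ ℝ (b - a)).isLinear _

lemma rayleigh_lower {n l m : ℕ} {Ω : Set (EuclideanSpace ℝ (Fin n))} (hO : IsOpen Ω)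
    (hb : Bornology.IsBounded Ω) (hc : Convex ℝ Ω)
    (V : Submodule ℝ (EuclideanSpace ℝ (Fin n) → ℝ))
    (hV : Module.finrank ℝ V = l + 1) (hVs : ∀ f ∈ V, ContDiff ℝ (⊤ : ℕ∞) f)
    (hm : m ≤ l) (p : Fin m → EuclideanSpace ℝ (Fin n)) {D : ℝ} (hD : 0 < D)
    (hp : ∀ x ∈ Ω, ∃ i, dist x (p i) ≤ D) :
    ∃ f ∈ V, f ≠ 0 ∧ ∫ x in Ω, f x ^ 2 ≤ 4 * D ^ 2 * ∫ x in Ω, ‖fderiv ℝ f x‖ ^ 2 := by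
  have hfd : FiniteDimensional ℝ V := Module.finite_of_finrank_pos (by omega)
  let A : Fin m → Set (EuclideanSpace ℝ (Fin n)) := fun i =>
    Ω ∩ ((⋂ j, {x | ‖x - p i‖ ≤ ‖x - p j‖}) ∩ ⋂ j, ⋂ (_ : j < i), {x | ‖x - p i‖ < ‖x - p j‖})
  have hAmem : ∀ i x, x ∈ A i ↔ x ∈ Ω ∧ (∀ j, ‖x - p i‖ ≤ ‖x - p j‖) ∧
      ∀ j, j < i → ‖x - p i‖ < ‖x - p j‖ := by
    intro i x; simp [A]
  have hAc : ∀ i, Convex ℝ (A i) := fun i =>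
    hc.inter ((convex_iInter fun j => convex_half_le _ _).inter
      (convex_iInter₂ fun j _ => convex_half_lt _ _))
  have hAm : ∀ i, MeasurableSet (A i) := by
    intro i
    refine hO.measurableSet.inter (MeasurableSet.inter ?_ ?_)
    · exact MeasurableSet.iInter fun j => measurableSet_le (by fun_prop) (by fun_prop)
    · exact MeasurableSet.iInter fun j => MeasurableSet.iInter fun _ =>
        measurableSet_lt (by fun_prop) (by fun_prop)
  have hAb : ∀ i, Bornology.IsBounded (A i) := fun i => hb.subset Set.inter_subset_left
  have hAD : ∀ i, A i ⊆ Metric.closedBall (p i) D := by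
    intro i x hx
    rw [hAmem] at hx
    obtain ⟨j, hj⟩ := hp x hx.1
    rw [Metric.mem_closedBall, dist_eq_norm]
    exact (hx.2.1 j).trans (dist_eq_norm x (p j) ▸ hj)
  have hU : Ω = ⋃ i, A i := by
    ext x
    simp only [Set.mem_iUnion]
    constructor
    · intro hx
      have hne : Nonempty (Fin m) := let ⟨i, _⟩ := hp x hx; ⟨i⟩
      obtain ⟨i0, hi0⟩ := Finite.exists_min (fun i => ‖x - p i‖)
      let T : Set (Fin m) := {i | ∀ j, ‖x - p i‖ ≤ ‖x - p j‖}
      obtain ⟨i, hi⟩ := T.toFinite.exists_minimal ⟨i0, hi0⟩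
      refine ⟨i, (hAmem i x).2 ⟨hx, hi.1, ?_⟩⟩
      intro j hj
      by_contra hcon
      have : j ∈ T := fun j' => (not_lt.1 hcon).trans (hi.1 j')
      exact absurd (hi.2 this hj.le) (not_le.2 hj)
    · rintro ⟨i, hi⟩
      exact hi.1
  have hdis : Pairwise (Function.onFun Disjoint A) := by
    have aux : ∀ i j, i < j → ∀ x, x ∈ A i → x ∈ A j → False := by
      intro i j hij x hi hj
      rw [hAmem] at hi hj
      exact absurd (hj.2.2 i hij) (not_lt.2 (hi.2.1 j))
    intro i j hij
    refine Set.disjoint_left.2 fun x hi hj => ?_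
    rcases lt_or_gt_of_ne hij with h | h
    · exact aux i j h x hi hj
    · exact aux j i h x hj hi
  have hsum : ∀ u : EuclideanSpace ℝ (Fin n) → ℝ, Continuous u →
      ∫ x in Ω, u x = ∑ i, ∫ x in A i, u x := by
    intro u hu
    conv_lhs => rw [hU]
    exact integral_iUnion_fintype hAm hdis (fun i => intOn (hAb i) hu)
  let w : Fin m → EuclideanSpace ℝ (Fin n) → ℝ := fun i x =>
    Real.exp (-(‖x - p i‖ ^ 2 / (2 * D ^ 2)))
  have hw : ∀ i, Continuous (w i) := fun i => by fun_prop
  have hi : ∀ (f : V) i, IntegrableOn (fun x => f.1 x * w i x) (A i) := fun f i =>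
    intOn (hAb i) ((hVs _ f.2).continuous.mul (hw i))
  let T : V →ₗ[ℝ] (Fin m → ℝ) :=
    { toFun := fun f i => ∫ x in A i, f.1 x * w i x
      map_add' := by
        intro f g
        ext i
        simp only [Submodule.coe_add, Pi.add_apply, add_mul]
        exact integral_add (hi f i) (hi g i)
      map_smul' := by
        intro c f
        ext i
        simp only [Submodule.coe_smul, Pi.smul_apply, smul_eq_mul, mul_assoc, RingHom.id_apply]
        exact integral_const_mul _ _ }
  have hker := LinearMap.ker_ne_bot_of_finrank_lt (f := T) (by rw [hV]; simp; omega)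
  obtain ⟨f, hf, hf0⟩ := (Submodule.ne_bot_iff _).1 hker
  refine ⟨f.1, f.2, fun h => hf0 (Subtype.ext h), ?_⟩
  have hfs := hVs _ f.2
  have hfc := hfs.continuous
  have hgc : Continuous fun x => ‖fderiv ℝ f.1 x‖ := (hfs.continuous_fderiv (by norm_num)).norm
  rw [hsum _ (by fun_prop), hsum (fun x => ‖fderiv ℝ f.1 x‖ ^ 2) (by fun_prop), Finset.mul_sum]
  refine Finset.sum_le_sum fun i _ => ?_
  refine poincare (hAm i) (hAc i) (p i) hD (hAD i) f.1 hfs ?_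
  exact congrFun (LinearMap.mem_ker.1 hf) i

lemma st_deriv_zero {s : ℝ} (hs : s ≤ 0) : deriv Real.smoothTransition s = 0 := by
  apply IsLocalMin.deriv_eq_zero
  refine Filter.Eventually.of_forall fun t => ?_
  rw [Real.smoothTransition.zero_of_nonpos hs]
  exact Real.smoothTransition.nonneg t

lemma st_deriv_zero' {s : ℝ} (hs : 1 ≤ s) : deriv Real.smoothTransition s = 0 := by
  apply IsLocalMax.deriv_eq_zero
  refine Filter.Eventually.of_forall fun t => ?_
  rw [Real.smoothTransition.one_of_one_le hs]
  exact Real.smoothTransition.le_one t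

lemma st_bound : ∃ K : ℝ, 0 < K ∧ ∀ s, |deriv Real.smoothTransition s| ≤ K := by
  have hc : Continuous (deriv Real.smoothTransition) :=
    (Real.smoothTransition.contDiff (n := 1)).continuous_deriv (by norm_num)
  obtain ⟨K, hK⟩ := (isCompact_Icc (a := (0:ℝ)) (b := 1)).exists_bound_of_continuousOn hc.continuousOn
  refine ⟨max K 1, by positivity, fun s => ?_⟩
  by_cases h0 : s ≤ 0
  · rw [st_deriv_zero h0]; simp
  by_cases h1 : 1 ≤ s
  · rw [st_deriv_zero' h1]; simp
  exact (hK s ⟨by linarith, by linarith⟩).trans (le_max_left _ _)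

lemma sum_sq_norm {ι E : Type*} [Fintype ι] [NormedAddCommGroup E] (v : ι → E)
    (h : ∀ i j, i ≠ j → v i = 0 ∨ v j = 0) : ‖∑ i, v i‖ ^ 2 = ∑ i, ‖v i‖ ^ 2 := by
  by_cases hv : ∃ i, v i ≠ 0
  · obtain ⟨i, hi⟩ := hv
    have hz : ∀ j, j ≠ i → v j = 0 := fun j hj => (h j i hj).resolve_right hi
    rw [Finset.sum_eq_single i (fun j _ hj => hz j hj) (by simp),
      Finset.sum_eq_single i (fun j _ hj => by rw [hz j hj]; simp) (by simp)]
  · push Not at hv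
    simp [hv]

noncomputable def bump {n : ℕ} (p : EuclideanSpace ℝ (Fin n)) (r : ℝ) :
    EuclideanSpace ℝ (Fin n) → ℝ :=
  fun x => Real.smoothTransition (2 * n * (1 - ‖x - p‖ ^ 2 / r ^ 2))

lemma bump_contDiff {n : ℕ} (p : EuclideanSpace ℝ (Fin n)) (r : ℝ) :
    ContDiff ℝ (⊤ : ℕ∞) (bump p r) := by
  unfold bump
  refine Real.smoothTransition.contDiff.comp ?_
  have : ContDiff ℝ (⊤ : ℕ∞) fun x : EuclideanSpace ℝ (Fin n) => ‖x - p‖ ^ 2 :=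
    (contDiff_id.sub contDiff_const).norm_sq ℝ
  exact contDiff_const.mul (contDiff_const.sub (this.div_const _))

lemma bump_zero {n : ℕ} (p : EuclideanSpace ℝ (Fin n)) {r : ℝ} (hr : 0 < r)
    {x : EuclideanSpace ℝ (Fin n)} (hx : r ≤ ‖x - p‖) : bump p r x = 0 := by
  unfold bump
  apply Real.smoothTransition.zero_of_nonpos
  have : 1 ≤ ‖x - p‖ ^ 2 / r ^ 2 := by
    rw [one_le_div (by positivity)]; gcongr
  have h2 : (0:ℝ) ≤ 2 * n := by positivity
  nlinarith

lemma bump_one {n : ℕ} (hn : 2 ≤ n) (p : EuclideanSpace ℝ (Fin n)) {r : ℝ} (hr : 0 < r)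
    {x : EuclideanSpace ℝ (Fin n)} (hx : ‖x - p‖ ≤ (1 - 1 / (2 * n)) * r) : bump p r x = 1 := by
  unfold bump
  apply Real.smoothTransition.one_of_one_le
  have hn' : (2:ℝ) ≤ n := by exact_mod_cast hn
  have h1 : 1 / (2 * (n:ℝ)) ≤ 1 := by
    rw [div_le_one (by positivity)]; linarith
  have h0 : 0 ≤ 1 / (2 * (n:ℝ)) := by positivity
  have : ‖x - p‖ ^ 2 / r ^ 2 ≤ 1 - 1 / (2 * n) := by
    rw [div_le_iff₀ (by positivity)]
    calc ‖x - p‖ ^ 2 ≤ ((1 - 1 / (2 * n)) * r) ^ 2 := by gcongr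
      _ = (1 - 1 / (2 * n)) ^ 2 * r ^ 2 := by ring
      _ ≤ _ := by gcongr; nlinarith
  calc (1:ℝ) = 2 * n * (1 / (2 * n)) := by field_simp
    _ ≤ _ := by gcongr; linarith

lemma bump_fderiv {n : ℕ} (p : EuclideanSpace ℝ (Fin n)) (r : ℝ) (x : EuclideanSpace ℝ (Fin n)) :
    fderiv ℝ (bump p r) x = (deriv Real.smoothTransition (2 * n * (1 - ‖x - p‖ ^ 2 / r ^ 2))
      * (2 * n * (- (2 / r ^ 2)))) • innerSL ℝ (x - p) := by
  have h1 : HasFDerivAt (fun x : EuclideanSpace ℝ (Fin n) => ‖x - p‖ ^ 2)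
      (2 • (innerSL ℝ (x - p)).comp (ContinuousLinearMap.id ℝ _)) x :=
    ((hasFDerivAt_id x).sub_const p).norm_sq
  have h2 : HasFDerivAt (fun x : EuclideanSpace ℝ (Fin n) => 2 * n * (1 - ‖x - p‖ ^ 2 * (r ^ 2)⁻¹))
    _ x := ((h1.mul_const ((r ^ 2)⁻¹)).const_sub 1).const_mul (2 * n : ℝ)
  have hS : HasDerivAt Real.smoothTransition _ (2 * n * (1 - ‖x - p‖ ^ 2 * (r ^ 2)⁻¹)) :=
    ((Real.smoothTransition.contDiff (n := 1)).differentiable (by norm_num) _).hasDerivAt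
  have h3 := (hS.comp_hasFDerivAt x h2).fderiv
  have e : bump p r = Real.smoothTransition ∘ fun x => 2 * n * (1 - ‖x - p‖ ^ 2 * (r ^ 2)⁻¹) := by
    ext x; simp [bump, div_eq_mul_inv]
  rw [e, h3]
  ext v
  simp [div_eq_mul_inv]
  ring

lemma bump_fderiv_zero {n : ℕ} (p : EuclideanSpace ℝ (Fin n)) {r : ℝ} (hr : 0 < r)
    {x : EuclideanSpace ℝ (Fin n)} (hx : r ≤ ‖x - p‖) : fderiv ℝ (bump p r) x = 0 := by
  rw [bump_fderiv, st_deriv_zero]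
  · simp
  have : 1 ≤ ‖x - p‖ ^ 2 / r ^ 2 := by
    rw [one_le_div (by positivity)]; gcongr
  have h2 : (0:ℝ) ≤ 2 * n := by positivity
  nlinarith

lemma bump_fderiv_le {n : ℕ} {K : ℝ} (hK : ∀ s, |deriv Real.smoothTransition s| ≤ K)
    (p : EuclideanSpace ℝ (Fin n)) {r : ℝ} (hr : 0 < r)
    (x : EuclideanSpace ℝ (Fin n)) : ‖fderiv ℝ (bump p r) x‖ ≤ 4 * K * n / r := by
  have hK0 : 0 ≤ K := (abs_nonneg _).trans (hK 0)
  by_cases hx : r ≤ ‖x - p‖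
  · rw [bump_fderiv_zero p hr hx, norm_zero]; positivity
  rw [bump_fderiv, norm_smul, innerSL_apply_norm, norm_mul, Real.norm_eq_abs, Real.norm_eq_abs]
  have : |2 * (n:ℝ) * (-(2 / r ^ 2))| = 4 * n / r ^ 2 := by
    rw [mul_neg, abs_neg, abs_of_nonneg (by positivity)]; ring
  rw [this]
  calc _ ≤ K * (4 * n / r ^ 2) * r := by
        gcongr
        · exact hK _
        · exact (not_le.1 hx).le
    _ = _ := by field_simp

lemma vol_ratio {n : ℕ} (hn : 2 ≤ n) {Ω : Set (EuclideanSpace ℝ (Fin n))} (hc : Convex ℝ Ω)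
    (hb : Bornology.IsBounded Ω) {p : EuclideanSpace ℝ (Fin n)} (hp : p ∈ Ω) {r : ℝ} :
    volume.real (Ω ∩ Metric.ball p r) ≤
      2 * volume.real (Ω ∩ Metric.closedBall p ((1 - 1 / (2 * n)) * r)) := by
  have hn' : (2:ℝ) ≤ n := by exact_mod_cast hn
  set s : ℝ := 1 - 1 / (2 * n) with hs
  have h1 : 1 / (2 * (n:ℝ)) ≤ 1 := by
    rw [div_le_one (by positivity)]; linarith
  have h0 : 0 ≤ 1 / (2 * (n:ℝ)) := by positivity
  have hs0 : 0 ≤ s := by linarith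
  have hs1 : s ≤ 1 := by linarith
  have hsub : AffineMap.homothety p s '' (Ω ∩ Metric.ball p r) ⊆
      Ω ∩ Metric.closedBall p (s * r) := by
    rintro _ ⟨x, ⟨hx, hxr⟩, rfl⟩
    constructor
    · rw [AffineMap.homothety_eq_lineMap]
      exact hc.lineMap_mem hp hx ⟨hs0, hs1⟩
    · rw [Metric.mem_closedBall, dist_eq_norm, AffineMap.homothety_apply]
      simp only [vsub_eq_sub, vadd_eq_add, add_sub_cancel_right, norm_smul]
      rw [Real.norm_of_nonneg hs0]
      have : ‖x - p‖ < r := by simpa [dist_eq_norm] using hxr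
      gcongr
  have hm : volume.real (AffineMap.homothety p s '' (Ω ∩ Metric.ball p r)) =
      s ^ n * volume.real (Ω ∩ Metric.ball p r) := by
    rw [measureReal_def, Measure.addHaar_image_homothety, ENNReal.toReal_mul,
      ENNReal.toReal_ofReal (abs_nonneg _), abs_of_nonneg (by positivity)]
    simp [measureReal_def]
  have hle : s ^ n * volume.real (Ω ∩ Metric.ball p r) ≤
      volume.real (Ω ∩ Metric.closedBall p (s * r)) := by
    rw [← hm]
    exact measureReal_mono hsub (hb.subset Set.inter_subset_left).measure_lt_top.ne
  have hbern : 1 / 2 ≤ s ^ n := by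
    have := one_add_mul_le_pow (a := -(1 / (2 * (n:ℝ)))) (by linarith) n
    have e : (1:ℝ) + n * (-(1 / (2 * (n:ℝ)))) = 1 / 2 := by field_simp; ring
    rw [e] at this
    rwa [← sub_eq_add_neg] at this
  have : 0 ≤ volume.real (Ω ∩ Metric.ball p r) := measureReal_nonneg
  nlinarith

lemma bump_rayleigh {n : ℕ} (hn : 2 ≤ n) {K : ℝ} (hK : ∀ s, |deriv Real.smoothTransition s| ≤ K)
    {Ω : Set (EuclideanSpace ℝ (Fin n))} (hO : IsOpen Ω) (hc : Convex ℝ Ω)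
    (hb : Bornology.IsBounded Ω) {p : EuclideanSpace ℝ (Fin n)} (hp : p ∈ Ω) {r : ℝ} (hr : 0 < r) :
    ∫ x in Ω, ‖fderiv ℝ (bump p r) x‖ ^ 2 ≤
      (32 * K ^ 2 * n ^ 2 / r ^ 2) * ∫ x in Ω, bump p r x ^ 2 := by
  have hK0 : 0 ≤ K := (abs_nonneg _).trans (hK 0)
  have hcb : Continuous (bump p r) := (bump_contDiff p r).continuous
  have hcg : Continuous (fun x => ‖fderiv ℝ (bump p r) x‖) :=
    ((bump_contDiff p r).continuous_fderiv (by norm_num)).norm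
  have hfin : volume Ω ≠ ⊤ := hb.measure_lt_top.ne
  have u : ∫ x in Ω, ‖fderiv ℝ (bump p r) x‖ ^ 2 ≤
      (4 * K * n / r) ^ 2 * volume.real (Ω ∩ Metric.ball p r) := by
    have : ∫ x in Ω, ‖fderiv ℝ (bump p r) x‖ ^ 2 ≤
        ∫ x in Ω, (Metric.ball p r).indicator (fun _ => (4 * K * n / r) ^ 2) x := by
      refine setIntegral_mono_on (intOn hb (by fun_prop)) ?_ hO.measurableSet ?_
      · exact (integrableOn_const hfin).indicator measurableSet_ball
      · intro x _
        by_cases hx : x ∈ Metric.ball p r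
        · rw [Set.indicator_of_mem hx]
          gcongr
          exact bump_fderiv_le hK p hr x
        · rw [Set.indicator_of_notMem hx, bump_fderiv_zero p hr (by
            simpa [dist_eq_norm] using hx)]
          simp
    rw [setIntegral_indicator measurableSet_ball, setIntegral_const, smul_eq_mul] at this
    linarith
  have v : volume.real (Ω ∩ Metric.closedBall p ((1 - 1 / (2 * n)) * r)) ≤
      ∫ x in Ω, bump p r x ^ 2 := by
    have : ∫ x in Ω, (Metric.closedBall p ((1 - 1 / (2 * n)) * r)).indicator (fun _ => (1:ℝ)) x ≤
        ∫ x in Ω, bump p r x ^ 2 := by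
      refine setIntegral_mono_on ?_ (intOn hb (by fun_prop)) hO.measurableSet ?_
      · exact (integrableOn_const hfin).indicator measurableSet_closedBall
      · intro x _
        by_cases hx : x ∈ Metric.closedBall p ((1 - 1 / (2 * n)) * r)
        · rw [Set.indicator_of_mem hx, bump_one hn p hr (by simpa [dist_eq_norm] using hx)]
          simp
        · rw [Set.indicator_of_notMem hx]; positivity
    rwa [setIntegral_indicator measurableSet_closedBall, setIntegral_const, smul_eq_mul,
      mul_one] at this
  have w := vol_ratio hn hc hb hp (r := r)
  calc _ ≤ (4 * K * n / r) ^ 2 * (2 * ∫ x in Ω, bump p r x ^ 2) := by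
        refine u.trans ?_
        gcongr
        linarith
    _ = _ := by ring

lemma test_space {n N : ℕ} (hn : 2 ≤ n) {K : ℝ} (hK : ∀ s, |deriv Real.smoothTransition s| ≤ K)
    {Ω : Set (EuclideanSpace ℝ (Fin n))} (hO : IsOpen Ω) (hc : Convex ℝ Ω)
    (hb : Bornology.IsBounded Ω) (p : Fin N → EuclideanSpace ℝ (Fin n)) (hp : ∀ i, p i ∈ Ω)
    {r : ℝ} (hr : 0 < r) (hsep : ∀ i j, i ≠ j → 2 * r ≤ dist (p i) (p j)) :
    ∃ V : Submodule ℝ (EuclideanSpace ℝ (Fin n) → ℝ),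
      (Module.finrank ℝ V = N ∧ (∀ f ∈ V, ContDiff ℝ (⊤ : ℕ∞) f) ∧
      ∀ f ∈ V, (∀ x ∈ Ω, f x = 0) → f = 0) ∧
      ∀ f ∈ V, ∫ x in Ω, ‖fderiv ℝ f x‖ ^ 2 ≤ (32 * K ^ 2 * n ^ 2 / r ^ 2) * ∫ x in Ω, f x ^ 2 := by
  let B : Fin N → EuclideanSpace ℝ (Fin n) → ℝ := fun i => bump (p i) r
  have hBs : ∀ i, ContDiff ℝ (⊤ : ℕ∞) (B i) := fun i => bump_contDiff _ _
  have hn' : (2:ℝ) ≤ n := by exact_mod_cast hn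
  have hdiag : ∀ i, B i (p i) = 1 := fun i => bump_one hn _ hr (by
    have h1 : 1 / (2 * (n:ℝ)) ≤ 1 := by
      rw [div_le_one (by positivity)]; linarith
    simp only [sub_self, norm_zero]
    exact mul_nonneg (by linarith) hr.le)
  have hfar : ∀ i j, i ≠ j → ∀ x, r ≤ ‖x - p i‖ ∨ r ≤ ‖x - p j‖ := by
    intro i j hij x
    by_contra hcon
    push Not at hcon
    have h1 := hsep i j hij
    have h2 : dist (p i) (p j) ≤ dist x (p i) + dist x (p j) := dist_triangle_left _ _ _
    rw [dist_eq_norm x, dist_eq_norm x] at h2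
    linarith
  have hoff : ∀ i j, i ≠ j → B i (p j) = 0 := by
    intro i j hij
    apply bump_zero _ hr
    rcases hfar i j hij (p j) with h | h
    · exact h
    · simp at h; linarith
  have hval : ∀ (c : Fin N → ℝ) j, (∑ i, c i • B i) (p j) = c j := by
    intro c j
    rw [Finset.sum_apply, Finset.sum_eq_single j]
    · simp [hdiag]
    · intro i _ hij; simp [hoff i j hij]
    · simp
  have hli : LinearIndependent ℝ B := by
    rw [Fintype.linearIndependent_iff]
    intro c hcz j
    rw [← hval c j, hcz]; rfl
  refine ⟨Submodule.span ℝ (Set.range B), ⟨?_, ?_, ?_⟩, ?_⟩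
  · rw [finrank_span_eq_card hli]; simp
  · intro f hf
    obtain ⟨c, rfl⟩ := (Submodule.mem_span_range_iff_exists_fun ℝ).1 hf
    have : (∑ i, c i • B i) = fun x => ∑ i, c i • B i x := by ext x; simp
    rw [this]
    exact ContDiff.sum fun i _ => (contDiff_const (c := c i)).smul (hBs i)
  · intro f hf hz
    obtain ⟨c, rfl⟩ := (Submodule.mem_span_range_iff_exists_fun ℝ).1 hf
    have : ∀ j, c j = 0 := fun j => by rw [← hval c j]; exact hz _ (hp j)
    simp [this]
  · intro f hf
    obtain ⟨c, rfl⟩ := (Submodule.mem_span_range_iff_exists_fun ℝ).1 hf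
    have e1 : ∀ x, (∑ i, c i • B i) x ^ 2 = ∑ i, c i ^ 2 * B i x ^ 2 := by
      intro x
      have := sum_sq_norm (fun i => c i * B i x) (by
        intro i j hij
        rcases hfar i j hij x with h | h
        · left; simp [B, bump_zero _ hr h]
        · right; simp [B, bump_zero _ hr h])
      simp only [Real.norm_eq_abs, sq_abs, mul_pow] at this
      simpa using this
    have e2 : ∀ x, ‖fderiv ℝ (∑ i, c i • B i) x‖ ^ 2 = ∑ i, c i ^ 2 * ‖fderiv ℝ (B i) x‖ ^ 2 := by
      intro x
      have hd : ∀ i, DifferentiableAt ℝ (B i) x := fun i => (hBs i).differentiable (by norm_num) x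
      have := sum_sq_norm (fun i => c i • fderiv ℝ (B i) x) (by
        intro i j hij
        rcases hfar i j hij x with h | h
        · left; simp [B, bump_fderiv_zero _ hr h]
        · right; simp [B, bump_fderiv_zero _ hr h])
      simp only [norm_smul, Real.norm_eq_abs, mul_pow, sq_abs] at this
      rw [← this, fderiv_sum (fun i _ => (hd i).const_smul (c i))]
      congr 2
      refine Finset.sum_congr rfl fun i _ => ?_
      rw [fderiv_const_smul (hd i)]
    simp only [e1, e2]
    have c1 : ∀ i, Continuous (B i) := fun i => (hBs i).continuous
    have c2 : ∀ i, Continuous (fun x => ‖fderiv ℝ (B i) x‖) := fun i =>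
      ((hBs i).continuous_fderiv (by norm_num)).norm
    have i1 : ∀ i, IntegrableOn (fun x => c i ^ 2 * B i x ^ 2) Ω := fun i =>
      intOn hb (((c1 i).pow 2).const_smul (c i ^ 2))
    have i2 : ∀ i, IntegrableOn (fun x => c i ^ 2 * ‖fderiv ℝ (B i) x‖ ^ 2) Ω := fun i =>
      intOn hb (((c2 i).pow 2).const_smul (c i ^ 2))
    rw [integral_finsetSum _ (fun i _ => i2 i), integral_finsetSum _ (fun i _ => i1 i),
      Finset.mul_sum]
    refine Finset.sum_le_sum fun i _ => ?_
    rw [integral_const_mul, integral_const_mul]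
    have := bump_rayleigh hn hK hO hc hb (hp i) hr
    calc _ ≤ c i ^ 2 * ((32 * K ^ 2 * n ^ 2 / r ^ 2) * ∫ x in Ω, B i x ^ 2) := by gcongr
      _ = _ := by ring

def SepPts {n : ℕ} (Ω : Set (EuclideanSpace ℝ (Fin n))) (R : ℝ) (m : ℕ) : Prop :=
  ∃ x : Fin m → EuclideanSpace ℝ (Fin n), (∀ i, x i ∈ Ω) ∧ ∀ i j, i ≠ j → R ≤ dist (x i) (x j)

lemma natcast_sep {i j : ℕ} (h : i ≠ j) : (1:ℝ) ≤ |(i:ℝ) - j| := by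
  have : (1:ℤ) ≤ |(i:ℤ) - j| := Int.one_le_abs (by omega)
  exact_mod_cast this

lemma sep_exists {n : ℕ} (hn : 2 ≤ n) {Ω : Set (EuclideanSpace ℝ (Fin n))} (hO : IsOpen Ω)
    (hne : Ω.Nonempty) (m : ℕ) : ∃ R, 0 < R ∧ SepPts Ω R m := by
  obtain ⟨p, hp⟩ := hne
  obtain ⟨ε, hε, hball⟩ := Metric.isOpen_iff.1 hO p hp
  let u : EuclideanSpace ℝ (Fin n) := EuclideanSpace.single ⟨0, by omega⟩ 1
  have hu : ‖u‖ = 1 := by simp [u]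
  have hδ : 0 < ε / (m + 1) := by positivity
  refine ⟨ε / (m + 1), hδ, fun i => p + ((i:ℕ) * (ε / (m + 1)) : ℝ) • u, ?_, ?_⟩
  · intro i
    apply hball
    rw [Metric.mem_ball, dist_eq_norm, add_sub_cancel_left, norm_smul, hu, mul_one,
      Real.norm_of_nonneg (by positivity)]
    have : ((i:ℕ):ℝ) < m + 1 := by
      have := i.2
      have : ((i:ℕ):ℝ) < m := by exact_mod_cast this
      linarith
    calc ((i:ℕ):ℝ) * (ε / (m + 1)) < (m + 1) * (ε / (m + 1)) := by gcongr
      _ = ε := by field_simp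
  · intro i j hij
    rw [dist_eq_norm, add_sub_add_left_eq_sub, ← sub_smul, norm_smul, hu, mul_one, ← sub_mul,
      norm_mul, Real.norm_eq_abs, Real.norm_of_nonneg hδ.le]
    have := natcast_sep (fun h => hij (Fin.ext h) : (i:ℕ) ≠ j)
    nlinarith

lemma sep_refine {n l m : ℕ} (hl : 1 ≤ l) (hm : 1 ≤ m) {Ω : Set (EuclideanSpace ℝ (Fin n))}
    (hc : Convex ℝ Ω) {R : ℝ} (hR : 0 < R) (h : SepPts Ω R (l + 1)) :
    SepPts Ω (R / (4 * m)) ((l + 1) * m) := by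
  obtain ⟨x, hx, hsep⟩ := h
  have hnt : Nontrivial (Fin (l + 1)) := Fin.nontrivial_iff_two_le.2 (by omega)
  have hm' : (1:ℝ) ≤ m := by exact_mod_cast hm
  have hq : ∀ i, ∃ u : EuclideanSpace ℝ (Fin n), ‖u‖ = R / 4 ∧
      ∀ t : ℝ, 0 ≤ t → t ≤ 1 → x i + t • u ∈ Ω := by
    intro i
    obtain ⟨j, hj⟩ := exists_ne i
    have hd : R ≤ ‖x j - x i‖ := by rw [← dist_eq_norm]; exact hsep j i hj
    have hd0 : 0 < ‖x j - x i‖ := hR.trans_le hd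
    refine ⟨(R / 4 / ‖x j - x i‖) • (x j - x i), ?_, ?_⟩
    · rw [norm_smul, Real.norm_of_nonneg (by positivity)]
      field_simp
    · intro t ht0 ht1
      rw [smul_smul]
      refine hc.add_smul_sub_mem (hx i) (hx j) ⟨by positivity, ?_⟩
      have : R / 4 / ‖x j - x i‖ ≤ 1 := by
        rw [div_le_one hd0]; linarith
      have h0 : 0 ≤ R / 4 / ‖x j - x i‖ := by positivity
      nlinarith
  choose u hu huΩ using hq
  let y : Fin (l + 1) × Fin m → EuclideanSpace ℝ (Fin n) := fun q =>
    x q.1 + (((q.2 : ℕ) : ℝ) / m) • u q.1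
  have ht : ∀ j : Fin m, ((j:ℕ):ℝ) / m ≤ 1 := by
    intro j
    rw [div_le_one (by linarith)]
    exact_mod_cast j.2.le
  have hyx : ∀ q, dist (y q) (x q.1) ≤ R / 4 := by
    intro q
    simp only [y]
    rw [dist_eq_norm, add_sub_cancel_left, norm_smul, hu, Real.norm_of_nonneg (by positivity)]
    nlinarith [ht q.2]
  have hysep : ∀ q q', q ≠ q' → R / (4 * m) ≤ dist (y q) (y q') := by
    rintro ⟨i, j⟩ ⟨i', j'⟩ hqq
    by_cases hi : i = i'
    · subst hi
      have hj : (j:ℕ) ≠ j' := fun h => hqq (by rw [Fin.ext h])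
      have := natcast_sep hj
      simp only [y]
      rw [dist_eq_norm, add_sub_add_left_eq_sub, ← sub_smul, norm_smul, hu, ← sub_div,
        norm_div, Real.norm_eq_abs, Real.norm_of_nonneg (by positivity : (0:ℝ) ≤ m)]
      calc R / (4 * m) = 1 / m * (R / 4) := by field_simp
        _ ≤ _ := by gcongr
    · have h1 := hsep i i' hi
      have h2 := hyx (i, j)
      have h3 := hyx (i', j')
      have h4 := dist_triangle4 (x i) (y (i, j)) (y (i', j')) (x i')
      rw [dist_comm (x i) (y (i, j))] at h4
      have h5 : R / (4 * m) ≤ R / 4 := by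
        gcongr; linarith
      simp only at h2 h3
      linarith
  refine ⟨fun a => y (finProdFinEquiv.symm a), fun a => huΩ _ _ (by positivity) (ht _), ?_⟩
  intro a b hab
  exact hysep _ _ (fun h => hab (finProdFinEquiv.symm.injective h))

lemma sep_mono {n a b : ℕ} (hab : a ≤ b) {Ω : Set (EuclideanSpace ℝ (Fin n))} {R : ℝ}
    (h : SepPts Ω R b) : SepPts Ω R a := by
  obtain ⟨x, hx, hs⟩ := h
  exact ⟨fun i => x (Fin.castLE hab i), fun i => hx _, fun i j hij =>
    hs _ _ (fun h => hij (Fin.castLE_injective hab h))⟩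

lemma sep_threshold {n l : ℕ} (hn : 2 ≤ n) (hl : 1 ≤ l) {Ω : Set (EuclideanSpace ℝ (Fin n))}
    (hO : IsOpen Ω) (hne : Ω.Nonempty) (hb : Bornology.IsBounded Ω) :
    ∃ R, 0 < R ∧ SepPts Ω R (l + 1) ∧ ¬ SepPts Ω (2 * R) (l + 1) := by
  let S : Set ℝ := {R | 0 < R ∧ SepPts Ω R (l + 1)}
  obtain ⟨R0, hR0, hs0⟩ := sep_exists hn hO hne (l + 1)
  have hSne : S.Nonempty := ⟨R0, hR0, hs0⟩
  have hSb : BddAbove S := by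
    refine ⟨Metric.diam Ω, ?_⟩
    rintro R ⟨_, x, hx, hs⟩
    have h01 : (⟨0, by omega⟩ : Fin (l+1)) ≠ ⟨1, by omega⟩ := by simp
    exact (hs _ _ h01).trans (Metric.dist_le_diam_of_mem hb (hx _) (hx _))
  have hpos : 0 < sSup S := hR0.trans_le (le_csSup hSb ⟨hR0, hs0⟩)
  obtain ⟨R, hR, hlt⟩ := exists_lt_of_lt_csSup hSne (half_lt_self hpos)
  refine ⟨R, hR.1, hR.2, fun hcon => ?_⟩
  have := le_csSup hSb (show 2 * R ∈ S from ⟨by linarith [hR.1], hcon⟩)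
  linarith

lemma cover_of_not_sep {n l : ℕ} {Ω : Set (EuclideanSpace ℝ (Fin n))} {R : ℝ}
    (h : ¬ SepPts Ω R (l + 1)) : ∃ m, m ≤ l ∧ ∃ p : Fin m → EuclideanSpace ℝ (Fin n),
      ∀ x ∈ Ω, ∃ i, dist x (p i) ≤ R := by
  classical
  have hex : ∃ m, ¬ SepPts Ω R m := ⟨_, h⟩
  have hmin := Nat.find_spec hex
  have hle : Nat.find hex ≤ l + 1 := Nat.find_min' hex h
  have h0 : Nat.find hex ≠ 0 := by
    intro h0
    rw [h0] at hmin
    exact hmin ⟨fun i => i.elim0, fun i => i.elim0, fun i => i.elim0⟩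
  obtain ⟨m, hm⟩ := Nat.exists_eq_succ_of_ne_zero h0
  have hsm : SepPts Ω R m := by
    by_contra hcon
    have := Nat.find_min' hex hcon
    omega
  rw [hm] at hmin
  obtain ⟨p, hp, hs⟩ := hsm
  refine ⟨m, by omega, p, ?_⟩
  intro x hx
  by_contra hcon
  push Not at hcon
  refine hmin ⟨Fin.cons x p, ?_, ?_⟩
  · intro i
    refine Fin.cases ?_ (fun j => ?_) i
    · simpa using hx
    · simpa using hp j
  · intro i j
    refine Fin.cases ?_ (fun i' => ?_) i <;> refine Fin.cases ?_ (fun j' => ?_) j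
    · simp
    · intro _; simpa using (hcon j').le
    · intro _; simpa [dist_comm] using (hcon i').le
    · intro hij
      simpa using hs i' j' (fun h => hij (by rw [h]))

lemma eig_upper {n k : ℕ} (hn : 2 ≤ n) {K : ℝ} (hK : ∀ s, |deriv Real.smoothTransition s| ≤ K)
    {Ω : Set (EuclideanSpace ℝ (Fin n))} (hO : IsOpen Ω) (hc : Convex ℝ Ω)
    (hb : Bornology.IsBounded Ω) {r : ℝ} (hr : 0 < r) (hs : SepPts Ω (2 * r) (k + 1)) :
    neumannEigenvalue n k Ω ≤ 32 * K ^ 2 * n ^ 2 / r ^ 2 := by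
  obtain ⟨p, hp, hsep⟩ := hs
  obtain ⟨V, hV, hR⟩ := test_space hn hK hO hc hb p hp hr hsep
  unfold neumannEigenvalue
  refine (ciInf_le ?_ ⟨V, hV⟩).trans ?_
  · refine ⟨0, ?_⟩
    rintro _ ⟨W, rfl⟩
    exact Real.iSup_nonneg fun f => div_nonneg (integral_nonneg fun x => by positivity)
      (integral_nonneg fun x => by positivity)
  · refine Real.iSup_le ?_ (by positivity)
    rintro ⟨f, hf, hf0⟩
    exact div_le_of_le_mul₀ (integral_nonneg fun x => by positivity) (by positivity) (hR f hf)

lemma eig_lower {n l : ℕ} (hn : 2 ≤ n) {Ω : Set (EuclideanSpace ℝ (Fin n))} (hO : IsOpen Ω)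
    (hc : Convex ℝ Ω) (hb : Bornology.IsBounded Ω) (hne : Ω.Nonempty) {D : ℝ} (hD : 0 < D)
    (hs : ¬ SepPts Ω D (l + 1)) :
    1 / (4 * D ^ 2) ≤ neumannEigenvalue n l Ω := by
  obtain ⟨m, hm, p, hp⟩ := cover_of_not_sep hs
  obtain ⟨K, _, hK⟩ := st_bound
  unfold neumannEigenvalue
  have hne' : Nonempty {V : Submodule ℝ (EuclideanSpace ℝ (Fin n) → ℝ) //
      Module.finrank ℝ V = l + 1 ∧ (∀ f ∈ V, ContDiff ℝ (⊤ : ℕ∞) f) ∧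
      ∀ f ∈ V, (∀ x ∈ Ω, f x = 0) → f = 0} := by
    obtain ⟨R, hR, q, hq, hqs⟩ := sep_exists hn hO hne (l + 1)
    obtain ⟨V, hV, _⟩ := test_space hn hK hO hc hb q hq (half_pos hR) (fun i j hij => by
      have := hqs i j hij; linarith)
    exact ⟨⟨V, hV⟩⟩
  refine le_ciInf ?_
  rintro ⟨V, hV, hVs, hVi⟩
  obtain ⟨f, hf, hf0, hle⟩ := rayleigh_lower hO hb hc V hV hVs hm p hD hp
  refine le_trans ?_ (le_ciSup (rayleigh_bdd hO hb V hV hVs hVi) ⟨f, hf, hf0⟩)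
  have hpos : 0 < ∫ x in Ω, f x ^ 2 := by
    apply intpos hO hb (hVs f hf).continuous
    by_contra hcon
    push Not at hcon
    exact hf0 (hVi f hf hcon)
  rw [div_le_div_iff₀ (by positivity) hpos]
  linarith

/-- There exists a universal numeric constant `c > 0` such that for every `n ≥ 2`,
every bounded convex domain `Ω ⊆ ℝⁿ`, and all integers `k ≥ l ≥ 1`, the Neumann
eigenvalues satisfy `μ_k(Ω) ≤ c·n^10 · (k/l)² · μ_l(Ω)`. -/
theorem main_upper_bound :
    ∃ c : ℝ, 0 < c ∧ ∀ n : ℕ, 2 ≤ n →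
      ∀ Ω : Set (EuclideanSpace ℝ (Fin n)),
        IsOpen Ω → Convex ℝ Ω → Bornology.IsBounded Ω → Ω.Nonempty →
        ∀ k l : ℕ, 1 ≤ l → l ≤ k →
          neumannEigenvalue n k Ω ≤
            c * (n : ℝ) ^ 10 * ((k : ℝ) / (l : ℝ)) ^ 2 * neumannEigenvalue n l Ω := by
  obtain ⟨K, hK0, hK⟩ := st_bound
  refine ⟨32 * 64 * 4 * 16 * K ^ 2, by positivity, ?_⟩
  intro n hn Ω hO hc hb hne k l hl hlk
  obtain ⟨R, hR, hs, hns⟩ := sep_threshold hn hl hO hne hb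
  have hlow := eig_lower hn hO hc hb hne (by positivity : 0 < 2 * R) hns
  set m := k / l + 1 with hm
  have hm1 : 1 ≤ m := by rw [hm]; exact Nat.le_add_left 1 _
  have hkm : k + 1 ≤ (l + 1) * m := by
    have h1 : k < l * (k / l + 1) := Nat.lt_mul_div_succ k (by omega)
    nlinarith
  have hm' : (1:ℝ) ≤ m := by exact_mod_cast hm1
  have hl' : (1:ℝ) ≤ l := by exact_mod_cast hl
  have hmle : (m:ℝ) ≤ 2 * (k / l) := by
    have h1 : ((k / l : ℕ) : ℝ) ≤ (k:ℝ) / l := Nat.cast_div_le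
    have h2 : (1:ℝ) ≤ (k:ℝ) / l := by
      rw [one_le_div (by linarith)]; exact_mod_cast hlk
    rw [hm]; push_cast; linarith
  have hs2 := sep_mono hkm (sep_refine hl hm1 hc hR hs)
  have hup := eig_upper (k := k) hn hK hO hc hb (r := R / (8 * m)) (by positivity) (by
    convert hs2 using 1
    field_simp; norm_num)
  have hn' : (1:ℝ) ≤ n := by exact_mod_cast (by omega : 1 ≤ n)
  have hn10 : (n:ℝ) ^ 2 ≤ (n:ℝ) ^ 10 := pow_le_pow_right₀ hn' (by norm_num)
  calc neumannEigenvalue n k Ω ≤ 32 * K ^ 2 * n ^ 2 / (R / (8 * m)) ^ 2 := hup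
    _ = 32 * 64 * 16 * K ^ 2 * n ^ 2 * (m:ℝ) ^ 2 * (1 / (4 * (2 * R) ^ 2)) := by
      field_simp; norm_num
    _ ≤ 32 * 64 * 16 * K ^ 2 * n ^ 10 * (2 * (k / l)) ^ 2 * neumannEigenvalue n l Ω := by
      gcongr
    _ = _ := by ring
end
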